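/- (Degeneration Theorem) For every compact interval P ⊂ (0,∞) and every δ < (log α)/2 there exist a closed interval Δ ⊂ (0,1) and N < ∞ such that: if f is a Lorenz map such that for some n ≥ 0 the renormalization R^n f lies in L_δ, is infinitely renormalizable of type Ω(N;P), and c(R^n f) ∉ Δ, then c(R^{2k} f) → 0 and c(R^{2k+1} f) → 1 as k → ∞ (or vice versa), and dist(c(R^k f), {0,1})/λ^k → 0 for every λ ∈ (0,1). -/

import Mathlib

open Set Filter Topology MeasureTheory Function

noncomputable section

/-- The nonlinearity `Nφ = D log Dφ = φ''/φ'`. -/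
def nonlinearity (φ : ℝ → ℝ) : ℝ → ℝ := fun x => deriv (deriv φ) x / deriv φ x

/-- The Schwarzian derivative `Sφ = D(Nφ) - (Nφ)²/2`. -/
def schwarzian (φ : ℝ → ℝ) : ℝ → ℝ := fun x =>
  deriv (nonlinearity φ) x - (nonlinearity φ x) ^ 2 / 2

/-- `φ` is an orientation-preserving C³ diffeomorphism of `[0,1]` with
nonpositive Schwarzian derivative. -/
structure IsSDiffeo (φ : ℝ → ℝ) : Prop where
  contDiff : ContDiffOn ℝ 3 φ (Icc 0 1)
  fix0 : φ 0 = 0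
  fix1 : φ 1 = 1
  derivPos : ∀ x ∈ Icc (0:ℝ) 1, 0 < deriv φ x
  schwNonpos : ∀ x ∈ Icc (0:ℝ) 1, schwarzian φ x ≤ 0

/-- The nonlinearity norm `‖φ‖ = sup |Nφ|` over `[0,1]`. -/
def diffeoNorm (φ : ℝ → ℝ) : ℝ := sSup ((fun x => |nonlinearity φ x|) '' Icc 0 1)

/-- Left branch of the standard family: `q₋(x) = u (1 - |(c-x)/c|^α)`. -/
def qminus (α u c : ℝ) : ℝ → ℝ := fun x => u * (1 - |(c - x) / c| ^ α)

/-- Right branch of the standard family: `q₊(x) = 1 + v (-1 + |(x-c)/(1-c)|^α)`. -/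
def qplus (α v c : ℝ) : ℝ → ℝ := fun x => 1 + v * (-1 + |(x - c) / (1 - c)| ^ α)

/-- A Lorenz map with critical exponent `α`: a tuple `(u,v,c,φ,ψ)` with
branches `f₋ = φ ∘ q₋` on `[0,c)` and `f₊ = ψ ∘ q₊` on `(c,1]`, such that
`x < f₋(x)` on `(0,c]` and `f₊(x) < x` on `[c,1)`. -/
structure LorenzMap (α : ℝ) where
  u : ℝ
  v : ℝ
  c : ℝ
  φ : ℝ → ℝ
  ψ : ℝ → ℝ
  hu : u ∈ Icc (0:ℝ) 1
  hv : v ∈ Icc (0:ℝ) 1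
  hc : c ∈ Ioo (0:ℝ) 1
  hφ : IsSDiffeo φ
  hψ : IsSDiffeo ψ
  hleft : ∀ x ∈ Ioc (0:ℝ) c, x < φ (qminus α u c x)
  hright : ∀ x ∈ Ico c (1:ℝ), ψ (qplus α v c x) < x

namespace LorenzMap

variable {α : ℝ}

/-- The left branch `f₋ = φ ∘ q₋`. -/
def fm (f : LorenzMap α) : ℝ → ℝ := fun x => f.φ (qminus α f.u f.c x)

/-- The right branch `f₊ = ψ ∘ q₊`. -/
def fp (f : LorenzMap α) : ℝ → ℝ := fun x => f.ψ (qplus α f.v f.c x)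

/-- The Lorenz map as a function (its value at the critical point itself is
irrelevant; we use the right branch there). -/
def toFun (f : LorenzMap α) : ℝ → ℝ := fun x => if x < f.c then f.fm x else f.fp x

/-- `f ∈ L_δ`: both diffeomorphic parts have nonlinearity norm `< δ`. -/
def memL (f : LorenzMap α) (δ : ℝ) : Prop := diffeoNorm f.φ < δ ∧ diffeoNorm f.ψ < δ

/-- The preimage `f₋⁻¹(y)` of a point under the left branch, taken in `[0, c]`. -/
def fmInv (f : LorenzMap α) : ℝ → ℝ := fun y => invFunOn f.fm (Icc 0 f.c) y

/-- The preimage `f₊⁻¹(y)` of a point under the right branch, taken in `[c, 1]`. -/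
def fpInv (f : LorenzMap α) : ℝ → ℝ := fun y => invFunOn f.fp (Icc f.c 1) y

end LorenzMap

/-- First return time of `x` to `C` under `F`. -/
def firstReturn (F : ℝ → ℝ) (C : Set ℝ) (x : ℝ) : ℕ := sInf {k : ℕ | 0 < k ∧ F^[k] x ∈ C}

/-- `[l,r] ⊊ [0,1]` is a renormalization interval for `f`, whose first-return map
is affinely conjugate to the Lorenz map `g`. -/
def IsRenormPair {α : ℝ} (f g : LorenzMap α) (l r : ℝ) : Prop :=
  0 ≤ l ∧ l < f.c ∧ f.c < r ∧ r ≤ 1 ∧ (0 < l ∨ r < 1) ∧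
  g.c = (f.c - l) / (r - l) ∧
  ∀ x ∈ Icc l r, x ≠ f.c →
    (∃ k, 0 < k ∧ f.toFun^[k] x ∈ Icc l r) ∧
    f.toFun^[firstReturn f.toFun (Icc l r) x] x = l + (r - l) * g.toFun ((x - l) / (r - l))

/-- `f` is renormalizable. -/
def Renormalizable {α : ℝ} (f : LorenzMap α) : Prop := ∃ g l r, IsRenormPair f g l r

/-- `[l,r]` is the return interval of `f`: the largest renormalization interval. -/
def IsReturnInterval {α : ℝ} (f : LorenzMap α) (l r : ℝ) : Prop :=
  (∃ g, IsRenormPair f g l r) ∧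
  ∀ g' l' r', IsRenormPair f g' l' r' → Icc l' r' ⊆ Icc l r

/-- `g = R f` is the renormalization of `f` (rescaled first-return map to the
return interval). -/
def IsRenormalizationOf {α : ℝ} (f g : LorenzMap α) : Prop :=
  ∃ l r, IsReturnInterval f l r ∧ IsRenormPair f g l r

/-- The `(a,b)` combinatorics of renormalization on the interval `[l,r]`, where
`C₋ = [l,c)` and `C₊ = (c,r]`:
`f(C₋) > f²(C₋) > ⋯ > f^a(C₋) > c`, `C₋ ⊂ f^(a+1)(C₋) ⊂ C`, and
`f(C₊) < f²(C₊) < ⋯ < f^b(C₊) < c`, `C₊ ⊂ f^(b+1)(C₊) ⊂ C`. -/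
def ABCombinatorics {α : ℝ} (f : LorenzMap α) (l r : ℝ) (a b : ℕ) : Prop :=
  0 < a ∧ 0 < b ∧
  (∀ i, 1 ≤ i → i ≤ a → ∀ x ∈ Ico l f.c, f.c < f.toFun^[i] x) ∧
  (∀ i, 1 ≤ i → i + 1 ≤ a → ∀ x ∈ Ico l f.c, ∀ y ∈ Ico l f.c,
    f.toFun^[i+1] x < f.toFun^[i] y) ∧
  Ico l f.c ⊆ f.toFun^[a+1] '' Ico l f.c ∧ f.toFun^[a+1] '' Ico l f.c ⊆ Icc l r ∧
  (∀ i, 1 ≤ i → i ≤ b → ∀ x ∈ Ioc f.c r, f.toFun^[i] x < f.c) ∧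
  (∀ i, 1 ≤ i → i + 1 ≤ b → ∀ x ∈ Ioc f.c r, ∀ y ∈ Ioc f.c r,
    f.toFun^[i] x < f.toFun^[i+1] y) ∧
  Ioc f.c r ⊆ f.toFun^[b+1] '' Ioc f.c r ∧ f.toFun^[b+1] '' Ioc f.c r ⊆ Icc l r

/-- `f` is `(a,b)`-renormalizable with return interval `[l,r]`. -/
def ABRenormWith {α : ℝ} (f : LorenzMap α) (a b : ℕ) (l r : ℝ) : Prop :=
  IsReturnInterval f l r ∧ ABCombinatorics f l r a b

/-- `f` is `(a,b)`-renormalizable. -/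
def ABRenormalizable {α : ℝ} (f : LorenzMap α) (a b : ℕ) : Prop :=
  ∃ l r, ABRenormWith f a b l r

/-- A sequence of successive renormalizations: `F (k+1) = R (F k)`. -/
def RenormSeq {α : ℝ} (F : ℕ → LorenzMap α) : Prop :=
  ∀ k, IsRenormalizationOf (F k) (F (k + 1))

/-- The successive renormalizations `F k = Rᵏ f` degenerate: the critical points
alternately tend to `0` and `1`, at a rate faster than any exponential. -/
def Degenerates {α : ℝ} (F : ℕ → LorenzMap α) : Prop :=
  ((Tendsto (fun k => (F (2 * k)).c) atTop (nhds 0) ∧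
    Tendsto (fun k => (F (2 * k + 1)).c) atTop (nhds 1)) ∨
   (Tendsto (fun k => (F (2 * k)).c) atTop (nhds 1) ∧
    Tendsto (fun k => (F (2 * k + 1)).c) atTop (nhds 0))) ∧
  ∀ lam ∈ Ioo (0:ℝ) 1,
    Tendsto (fun k => min (F k).c (1 - (F k).c) / lam ^ k) atTop (nhds 0)

/-- A priori bounds: the family of successive renormalizations `F k = Rᵏ f` is
relatively compact in the C⁰ (product) topology: every subsequence has a further
subsequence converging (in `(u,v,c)` and uniformly on `[0,1]` in the diffeomorphic
parts) to a Lorenz map. -/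
def APrioriBounds {α : ℝ} (F : ℕ → LorenzMap α) : Prop :=
  ∀ σ : ℕ → ℕ, StrictMono σ → ∃ τ : ℕ → ℕ, StrictMono τ ∧ ∃ g : LorenzMap α,
    Tendsto (fun j => (F (σ (τ j))).u) atTop (nhds g.u) ∧
    Tendsto (fun j => (F (σ (τ j))).v) atTop (nhds g.v) ∧
    Tendsto (fun j => (F (σ (τ j))).c) atTop (nhds g.c) ∧
    TendstoUniformlyOn (fun j => (F (σ (τ j))).φ) g.φ atTop (Icc 0 1) ∧
    TendstoUniformlyOn (fun j => (F (σ (τ j))).ψ) g.ψ atTop (Icc 0 1)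

noncomputable section

/-- Cross-ratio expansion on `[A,B]`. -/
def CRx (h : ℝ → ℝ) (A B : ℝ) : Prop :=
  ∀ p x y q, A ≤ p → p ≤ x → x ≤ y → y ≤ q → q ≤ B →
    (h x - h p) * (h q - h y) * ((y - x) * (q - p)) ≤
      (h y - h x) * (h q - h p) * ((x - p) * (q - y))

/-- Distortion of adjacent intervals. -/
def DPx (K : ℝ) (h : ℝ → ℝ) : Prop :=
  ∀ x y z, 0 ≤ x → x ≤ y → y ≤ z → z ≤ 1 →
    (h y - h x) * (z - y) ≤ K * ((h z - h y) * (y - x)) ∧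
    (h z - h y) * (y - x) ≤ K * ((h y - h x) * (z - y))

structure Weak (K : ℝ) (φ : ℝ → ℝ) : Prop where
  mono : StrictMonoOn φ (Icc 0 1)
  cont : ContinuousOn φ (Icc 0 1)
  z0 : φ 0 = 0
  z1 : φ 1 = 1
  cr : CRx φ 0 1
  dp : DPx K φ

lemma sdist_aux {A B : ℝ} {h g : ℝ → ℝ} (hg : ∀ x ∈ Ioo A B, 0 < g x)
    (hh : ∀ x ∈ Ioo A B, HasDerivAt h (1 / g x ^ 2) x) (hc : ConvexOn ℝ (Ioo A B) g)
    {s t : ℝ} (hs : s ∈ Ioo A B) (ht : t ∈ Ioo A B) (hst : s < t) :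
    (t - s) / (g s * g t) ≤ h t - h s := by
  have hsub : Icc s t ⊆ Ioo A B := fun x hx => ⟨lt_of_lt_of_le hs.1 hx.1, lt_of_le_of_lt hx.2 ht.2⟩
  set m := (g t - g s) / (t - s) with hm
  have hts : 0 < t - s := by linarith
  have hgs := hg s hs
  have hgt := hg t ht
  have hchord : ∀ x ∈ Icc s t, g x ≤ g s + m * (x - s) := by
    intro x hx
    have := hc.2 hs ht
      (show 0 ≤ (t - x) / (t - s) from div_nonneg (by linarith [hx.2]) hts.le)
      (show 0 ≤ (x - s) / (t - s) from div_nonneg (by linarith [hx.1]) hts.le)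
      (by field_simp; ring)
    have e : ((t - x) / (t - s)) • s + ((x - s) / (t - s)) • t = x := by
      simp only [smul_eq_mul]; field_simp; ring
    rw [e] at this
    refine this.trans (le_of_eq ?_)
    simp only [smul_eq_mul, hm]; field_simp; ring
  have hpos : ∀ x ∈ Icc s t, 0 < g s + m * (x - s) := fun x hx =>
    lt_of_lt_of_le (hg x (hsub hx)) (hchord x hx)
  have hk : ∀ x ∈ Icc s t, HasDerivAt (fun x => (x - s) / (g s * (g s + m * (x - s))))
      (1 / (g s + m * (x - s)) ^ 2) x := by
    intro x hx
    have hp := hpos x hx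
    have h1 : HasDerivAt (fun x : ℝ => x - s) 1 x := (hasDerivAt_id x).sub_const s
    have h2 : HasDerivAt (fun x : ℝ => g s * (g s + m * (x - s))) (g s * (m * 1)) x :=
      ((h1.const_mul m).const_add (g s)).const_mul (g s)
    have := h1.div h2 (by positivity)
    refine this.congr_deriv ?_
    generalize hG : g s + m * (x - s) = G at *
    have : m * (x - s) = G - g s := by linarith
    rw [div_eq_div_iff (by positivity) (by positivity)]
    linear_combination (-(g s * G ^ 2)) * this
  have hmon : MonotoneOn (fun x => h x - (x - s) / (g s * (g s + m * (x - s)))) (Icc s t) := by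
    apply monotoneOn_of_deriv_nonneg (convex_Icc s t)
    · intro x hx
      exact ((hh x (hsub hx)).sub (hk x hx)).continuousAt.continuousWithinAt
    · intro x hx
      rw [interior_Icc] at hx
      exact ((hh x (hsub (Ioo_subset_Icc_self hx))).sub
        (hk x (Ioo_subset_Icc_self hx))).differentiableAt.differentiableWithinAt
    · intro x hx
      rw [interior_Icc] at hx
      have hx' := Ioo_subset_Icc_self hx
      have hd := ((hh x (hsub hx')).sub (hk x hx')).deriv
      have e : deriv (fun x => h x - (x - s) / (g s * (g s + m * (x - s)))) x = _ := hd
      rw [e, sub_nonneg]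
      have := hg x (hsub hx')
      have := hchord x hx'
      gcongr
  have := hmon (left_mem_Icc.2 hst.le) (right_mem_Icc.2 hst.le) hst.le
  have e : g s + m * (t - s) = g t := by rw [hm]; field_simp; ring
  simp only [e, sub_self, zero_div, sub_zero] at this
  linarith

lemma cr_open {A B : ℝ} {h g : ℝ → ℝ} (hg : ∀ x ∈ Ioo A B, 0 < g x)
    (hh : ∀ x ∈ Ioo A B, HasDerivAt h (1 / g x ^ 2) x) (hc : ConvexOn ℝ (Ioo A B) g)
    {p x y q : ℝ} (hp : A < p) (hpx : p < x) (hxy : x < y) (hyq : y < q) (hq : q < B) :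
    (h x - h p) * (h q - h y) * ((y - x) * (q - p)) ≤
      (h y - h x) * (h q - h p) * ((x - p) * (q - y)) := by
  have hinc : ∀ s ∈ Ioo A B, ∀ t ∈ Ioo A B, s < t → 0 < h t - h s := by
    intro s hs t ht hst
    refine lt_of_lt_of_le ?_ (sdist_aux hg hh hc hs ht hst)
    have := hg s hs; have := hg t ht
    have : 0 < t - s := by linarith
    positivity
  -- Q t s antitone in s
  have hQ : ∀ t ∈ Ioo A B, AntitoneOn (fun s => 1 / g t ^ 2 / (h t - h s) - 1 / (t - s)) (Ioo A t) := by
    intro t ht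
    have hd : ∀ s ∈ Ioo A t, HasDerivAt (fun s => 1 / g t ^ 2 / (h t - h s) - 1 / (t - s))
        (1 / g t ^ 2 * (1 / g s ^ 2) / (h t - h s) ^ 2 - 1 / (t - s) ^ 2) s := by
      intro s hs
      have hs' : s ∈ Ioo A B := ⟨hs.1, hs.2.trans ht.2⟩
      have h0 := (hinc s hs' t ht hs.2).ne'
      have h00 : t - s ≠ 0 := by linarith [hs.2]
      have h1 := (hasDerivAt_const s (1 / g t ^ 2)).div ((hh s hs').const_sub (h t)) h0
      have h2 := (hasDerivAt_const s (1:ℝ)).div ((hasDerivAt_id s).const_sub t) h00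
      refine (h1.sub h2).congr_deriv ?_
      have := (hg s hs').ne'; have := (hg t ht).ne'
      simp only [id]
      field_simp
      ring
    apply antitoneOn_of_deriv_nonpos (convex_Ioo A t)
    · exact fun s hs => (hd s hs).continuousAt.continuousWithinAt
    · intro s hs
      rw [interior_Ioo] at hs
      exact (hd s hs).differentiableAt.differentiableWithinAt
    · intro s hs
      rw [interior_Ioo] at hs
      have hs' : s ∈ Ioo A B := ⟨hs.1, hs.2.trans ht.2⟩
      rw [(hd s hs).deriv, sub_nonpos]
      have h0 := hinc s hs' t ht hs.2
      have h00 : 0 < t - s := by linarith [hs.2]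
      have h3 := sdist_aux hg hh hc hs' ht hs.2
      have a1 := hg s hs'; have a2 := hg t ht
      rw [div_le_div_iff₀ (by positivity) (by positivity)]
      rw [div_le_iff₀ (by positivity)] at h3
      have h4 : (t - s) ^ 2 ≤ ((h t - h s) * (g s * g t)) ^ 2 := by gcongr
      have e : 1 / g t ^ 2 * (1 / g s ^ 2) * (t - s) ^ 2 = (t - s) ^ 2 / (g s * g t) ^ 2 := by
        field_simp
      rw [e, div_le_iff₀ (by positivity)]
      nlinarith
  have hpm : p ∈ Ioo A B := ⟨hp, by linarith⟩
  have hxm : x ∈ Ioo A B := ⟨by linarith, by linarith⟩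
  have hW : MonotoneOn (fun t => (Real.log (h t - h p) - Real.log (t - p)) -
      (Real.log (h t - h x) - Real.log (t - x))) (Ioo x B) := by
    have hd : ∀ t ∈ Ioo x B, HasDerivAt (fun t => (Real.log (h t - h p) - Real.log (t - p)) -
      (Real.log (h t - h x) - Real.log (t - x)))
        ((1 / g t ^ 2 / (h t - h p) - 1 / (t - p)) - (1 / g t ^ 2 / (h t - h x) - 1 / (t - x))) t := by
      intro t ht
      have ht' : t ∈ Ioo A B := ⟨by linarith [ht.1], ht.2⟩
      have h1 := ((hh t ht').sub_const (h p)).log (hinc p hpm t ht' (by linarith [ht.1])).ne'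
      have h2 := ((hasDerivAt_id t).sub_const p).log (by simp only [id]; linarith [ht.1])
      have h3 := ((hh t ht').sub_const (h x)).log (hinc x hxm t ht' (by linarith [ht.1])).ne'
      have h4 := ((hasDerivAt_id t).sub_const x).log (by simp only [id]; linarith [ht.1])
      exact (h1.sub h2).sub (h3.sub h4)
    apply monotoneOn_of_deriv_nonneg (convex_Ioo x B)
    · exact fun s hs => (hd s hs).continuousAt.continuousWithinAt
    · intro s hs
      rw [interior_Ioo] at hs
      exact (hd s hs).differentiableAt.differentiableWithinAt
    · intro t ht
      rw [interior_Ioo] at ht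
      rw [(hd t ht).deriv, sub_nonneg]
      exact hQ t ⟨by linarith [ht.1], ht.2⟩ ⟨hp, by linarith [ht.1]⟩ ⟨hxm.1, ht.1⟩ hpx.le
  have hym : y ∈ Ioo A B := ⟨by linarith, by linarith⟩
  have hqm : q ∈ Ioo A B := ⟨by linarith, by linarith⟩
  have := hW (show y ∈ Ioo x B from ⟨hxy, by linarith⟩) (show q ∈ Ioo x B from ⟨by linarith, hq⟩) hyq.le
  simp only at this
  have e1 := hinc p hpm y hym (by linarith)
  have e2 := hinc x hxm y hym (by linarith)
  have e3 := hinc p hpm q hqm (by linarith)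
  have e4 := hinc x hxm q hqm (by linarith)
  have f1 : 0 < y - p := by linarith
  have f2 : 0 < y - x := by linarith
  have f3 : 0 < q - p := by linarith
  have f4 : 0 < q - x := by linarith
  have key : Real.log ((h y - h p) * (h q - h x) * ((y - x) * (q - p))) ≤
      Real.log ((h q - h p) * (h y - h x) * ((y - p) * (q - x))) := by
    rw [Real.log_mul (by positivity) (by positivity), Real.log_mul (by positivity) (by positivity),
      Real.log_mul (by positivity) (by positivity), Real.log_mul (by positivity) (by positivity),
      Real.log_mul (by positivity) (by positivity), Real.log_mul (by positivity) (by positivity)]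
    linarith
  have key2 := (Real.log_le_log_iff (by positivity) (by positivity)).1 key
  nlinarith

lemma cr_closed {A B : ℝ} (hAB : A < B) {h g : ℝ → ℝ} (hg : ∀ x ∈ Ioo A B, 0 < g x)
    (hh : ∀ x ∈ Ioo A B, HasDerivAt h (1 / g x ^ 2) x) (hc : ConvexOn ℝ (Ioo A B) g)
    (hcont : ContinuousOn h (Icc A B)) : CRx h A B := by
  intro p x y q hp hpx hxy hyq hq
  rcases hpx.eq_or_lt with rfl | hpx
  · simp
  rcases hxy.eq_or_lt with rfl | hxy
  · simp
  rcases hyq.eq_or_lt with rfl | hyq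
  · simp
  have hten : ∀ z ∈ Icc A B, Tendsto (fun e : ℝ => h ((1 - e) * z + e * ((A + B) / 2)))
      (𝓝[Ioo 0 1] 0) (𝓝 (h z)) := by
    intro z hz
    have h1 := hcont z hz
    have h2 : Tendsto (fun e : ℝ => (1 - e) * z + e * ((A + B) / 2)) (𝓝[Ioo 0 1] 0) (𝓝[Icc A B] z) := by
      apply tendsto_nhdsWithin_of_tendsto_nhds_of_eventually_within
      · have : Continuous (fun e : ℝ => (1 - e) * z + e * ((A + B) / 2)) := by fun_prop
        have := (this.tendsto 0).mono_left (nhdsWithin_le_nhds (s := Ioo (0:ℝ) 1))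
        simpa using this
      · filter_upwards [self_mem_nhdsWithin] with e he
        constructor <;> nlinarith [hz.1, hz.2, he.1, he.2]
    exact h1.tendsto.comp h2
  have hidt : ∀ z : ℝ, Tendsto (fun e : ℝ => ((1 - e) * z + e * ((A + B) / 2)))
      (𝓝[Ioo 0 1] 0) (𝓝 z) := by
    intro z
    have : Continuous (fun e : ℝ => (1 - e) * z + e * ((A + B) / 2)) := by fun_prop
    have := (this.tendsto 0).mono_left (nhdsWithin_le_nhds (s := Ioo (0:ℝ) 1))
    simpa using this
  have tp := hten p ⟨by linarith, by linarith⟩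
  have tx := hten x ⟨by linarith, by linarith⟩
  have ty := hten y ⟨by linarith, by linarith⟩
  have tq := hten q ⟨by linarith, by linarith⟩
  have : (𝓝[Ioo (0:ℝ) 1] 0).NeBot := by
    apply mem_closure_iff_nhdsWithin_neBot.1
    rw [closure_Ioo (by norm_num)]; simp
  refine le_of_tendsto_of_tendsto
    (((tx.sub tp).mul (tq.sub ty)).mul (((hidt y).sub (hidt x)).mul ((hidt q).sub (hidt p))))
    (((ty.sub tx).mul (tq.sub tp)).mul (((hidt x).sub (hidt p)).mul ((hidt q).sub (hidt y)))) ?_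
  filter_upwards [self_mem_nhdsWithin] with e he
  have he1 : 0 < 1 - e := by linarith [he.2]
  apply cr_open hg hh hc
  · nlinarith [he.1]
  · nlinarith
  · nlinarith
  · nlinarith
  · nlinarith [he.1]

lemma cr_rpow {α : ℝ} (hα : 1 < α) : CRx (fun x => x ^ α) 0 1 := by
  have hg : ∀ x ∈ Ioo (0:ℝ) 1, 0 < (1 / Real.sqrt α) * x ^ (-((α - 1) / 2)) := by
    intro x hx
    have := Real.rpow_pos_of_pos hx.1 (-((α - 1) / 2))
    have : 0 < Real.sqrt α := Real.sqrt_pos.2 (by linarith)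
    positivity
  apply cr_closed (by norm_num) hg
  · intro x hx
    have h1 := Real.hasDerivAt_rpow_const (x := x) (p := α) (Or.inl hx.1.ne')
    convert h1 using 1
    have h2 : (x ^ (-((α - 1) / 2))) ^ 2 = x ^ (-(α - 1)) := by
      rw [← Real.rpow_natCast, ← Real.rpow_mul hx.1.le]; congr 1; push_cast; ring
    rw [mul_pow, h2, div_pow, Real.sq_sqrt (by linarith), Real.rpow_neg hx.1.le]
    have := Real.rpow_pos_of_pos hx.1 (α - 1)
    field_simp
  · have : ConvexOn ℝ (Ioi (0:ℝ)) (fun x : ℝ => x ^ (-((α - 1) / 2))) :=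
by
      have h1 : ConvexOn ℝ (Ioi (0:ℝ)) (fun x : ℝ => ((α - 1) / 2) • (-Real.log x)) :=
        (strictConcaveOn_log_Ioi.concaveOn.neg).smul (by linarith)
      have h2 : ConvexOn ℝ (Ioi (0:ℝ)) (Real.exp ∘ (fun x : ℝ => ((α - 1) / 2) • (-Real.log x))) :=
        ConvexOn.comp (convexOn_exp.subset (subset_univ _) ?_) h1 (Real.exp_monotone.monotoneOn _)
      · refine h2.congr ?_
        intro x hx
        simp only [comp, smul_eq_mul]
        rw [Real.rpow_def_of_pos hx]; congr 1; ring
      · have : ContinuousOn (fun x : ℝ => ((α - 1) / 2) • (-Real.log x)) (Ioi 0) := by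
          exact ((Real.continuousOn_log.mono (fun x hx => (ne_of_gt hx : x ≠ 0))).neg).const_smul ((α - 1) / 2)
        exact (((convex_Ioi (0:ℝ)).isPreconnected).image _ this).ordConnected.convex
    exact (this.subset (fun x hx => hx.1) (convex_Ioo 0 1)).smul (by positivity)
  · exact (Real.continuous_rpow_const (by linarith)).continuousOn

end

noncomputable section

lemma sdiffeo_diffAt {φ : ℝ → ℝ} (h : IsSDiffeo φ) {x : ℝ} (hx : x ∈ Icc (0:ℝ) 1) :
    DifferentiableAt ℝ φ x := differentiableAt_of_deriv_ne_zero (h.derivPos x hx).ne'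

lemma sdiffeo_mono {φ : ℝ → ℝ} (h : IsSDiffeo φ) : StrictMonoOn φ (Icc 0 1) := by
  apply strictMonoOn_of_deriv_pos (convex_Icc 0 1) h.contDiff.continuousOn
  intro x hx
  exact h.derivPos x (interior_subset hx)

lemma sdiffeo_d1 {φ : ℝ → ℝ} (h : IsSDiffeo φ) : ContDiffOn ℝ 2 (deriv φ) (Ioo 0 1) :=
  (h.contDiff.mono Ioo_subset_Icc_self).deriv_of_isOpen isOpen_Ioo (by norm_num)

lemma sdiffeo_d2 {φ : ℝ → ℝ} (h : IsSDiffeo φ) : ContDiffOn ℝ 1 (deriv (deriv φ)) (Ioo 0 1) :=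
  (sdiffeo_d1 h).deriv_of_isOpen isOpen_Ioo (by norm_num)

lemma sdiffeo_bdd {φ : ℝ → ℝ} (h : IsSDiffeo φ) :
    BddAbove ((fun x => |nonlinearity φ x|) '' Icc 0 1) := by
  have hu : UniqueDiffOn ℝ (Icc (0:ℝ) 1) := uniqueDiffOn_Icc (by norm_num)
  have c1 : ContDiffOn ℝ 2 (derivWithin φ (Icc 0 1)) (Icc 0 1) :=
    h.contDiff.derivWithin hu (by norm_num)
  have c2 : ContDiffOn ℝ 1 (derivWithin (derivWithin φ (Icc 0 1)) (Icc 0 1)) (Icc 0 1) :=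
    c1.derivWithin hu (by norm_num)
  have e1 : ∀ x ∈ Icc (0:ℝ) 1, derivWithin φ (Icc 0 1) x = deriv φ x := fun x hx =>
    (sdiffeo_diffAt h hx).derivWithin (hu x hx)
  have hq : ContinuousOn (fun x => |derivWithin (derivWithin φ (Icc 0 1)) (Icc 0 1) x /
      derivWithin φ (Icc 0 1) x|) (Icc 0 1) := by
    apply ContinuousOn.abs
    apply c2.continuousOn.div c1.continuousOn
    intro x hx
    rw [e1 x hx]; exact (h.derivPos x hx).ne'
  obtain ⟨M, hM⟩ := isCompact_Icc.bddAbove_image hq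
  refine ⟨max M (max |nonlinearity φ 0| |nonlinearity φ 1|), ?_⟩
  rintro _ ⟨x, hx, rfl⟩
  rcases hx.1.eq_or_lt with rfl | h0
  · simp
  rcases hx.2.eq_or_lt with rfl | h1
  · simp
  refine le_max_of_le_left ?_
  have hn : Icc (0:ℝ) 1 ∈ 𝓝 x := Icc_mem_nhds h0 h1
  have e2 : derivWithin (derivWithin φ (Icc 0 1)) (Icc 0 1) x = deriv (deriv φ) x := by
    rw [derivWithin_of_mem_nhds hn]
    apply Filter.EventuallyEq.deriv_eq
    filter_upwards [hn] with y hy using e1 y hy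
  have := hM (mem_image_of_mem _ hx)
  simp only [e2, e1 x hx] at this
  exact this

lemma sdiffeo_N {φ : ℝ → ℝ} (h : IsSDiffeo φ) {δ : ℝ} (hδ : diffeoNorm φ < δ) {x : ℝ}
    (hx : x ∈ Icc (0:ℝ) 1) : |nonlinearity φ x| ≤ δ :=
  (le_csSup (sdiffeo_bdd h) (mem_image_of_mem _ hx)).trans hδ.le

lemma sdiffeo_log {φ : ℝ → ℝ} (h : IsSDiffeo φ) {x : ℝ} (hx : x ∈ Ioo (0:ℝ) 1) :
    HasDerivAt (fun x => Real.log (deriv φ x)) (nonlinearity φ x) x := by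
  have h1 : DifferentiableAt ℝ (deriv φ) x :=
    ((sdiffeo_d1 h).contDiffAt (isOpen_Ioo.mem_nhds hx)).differentiableAt (by norm_num)
  exact h1.hasDerivAt.log (h.derivPos x (Ioo_subset_Icc_self hx)).ne'

lemma sdiffeo_ratio {φ : ℝ → ℝ} (h : IsSDiffeo φ) {δ : ℝ} (hδ : diffeoNorm φ < δ) {x y : ℝ}
    (hx : x ∈ Ioo (0:ℝ) 1) (hy : y ∈ Ioo (0:ℝ) 1) : deriv φ x ≤ Real.exp δ * deriv φ y := by
  have h0 : 0 ≤ δ := (abs_nonneg _).trans (sdiffeo_N h hδ (Ioo_subset_Icc_self hx))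
  have := (convex_Ioo (0:ℝ) 1).norm_image_sub_le_of_norm_hasDerivWithin_le
    (f := fun x => Real.log (deriv φ x)) (C := δ)
    (fun z hz => (sdiffeo_log h hz).hasDerivWithinAt)
    (fun z hz => sdiffeo_N h hδ (Ioo_subset_Icc_self hz)) hy hx
  rw [Real.norm_eq_abs, Real.norm_eq_abs] at this
  have h2 : |x - y| ≤ 1 := by rw [abs_le]; constructor <;> linarith [hx.1, hx.2, hy.1, hy.2]
  have h3 := (le_abs_self _).trans (this.trans (mul_le_of_le_one_right h0 h2))
  have px := h.derivPos x (Ioo_subset_Icc_self hx)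
  have py := h.derivPos y (Ioo_subset_Icc_self hy)
  rw [← Real.exp_log px, ← Real.exp_log py, ← Real.exp_add]
  exact Real.exp_le_exp.2 (by linarith)

lemma sdiffeo_dp {φ : ℝ → ℝ} (h : IsSDiffeo φ) {δ : ℝ} (hδ : diffeoNorm φ < δ) :
    DPx (Real.exp δ) φ := by
  intro x y z hx hxy hyz hz
  rcases hxy.eq_or_lt with rfl | hxy
  · simp
  rcases hyz.eq_or_lt with rfl | hyz
  · simp
  have hc := h.contDiff.continuousOn
  obtain ⟨ξ, hξ, e1⟩ := exists_deriv_eq_slope φ hxy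
    (hc.mono (Icc_subset_Icc hx (by linarith)))
    (fun w hw => (sdiffeo_diffAt h ⟨by linarith [hw.1], by linarith [hw.2]⟩).differentiableWithinAt)
  obtain ⟨ζ, hζ, e2⟩ := exists_deriv_eq_slope φ hyz
    (hc.mono (Icc_subset_Icc (by linarith) hz))
    (fun w hw => (sdiffeo_diffAt h ⟨by linarith [hw.1], by linarith [hw.2]⟩).differentiableWithinAt)
  have m1 : ξ ∈ Ioo (0:ℝ) 1 := ⟨by linarith [hξ.1], by linarith [hξ.2]⟩
  have m2 : ζ ∈ Ioo (0:ℝ) 1 := ⟨by linarith [hζ.1], by linarith [hζ.2]⟩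
  have r1 := sdiffeo_ratio h hδ m1 m2
  have r2 := sdiffeo_ratio h hδ m2 m1
  have a1 : 0 < y - x := by linarith
  have a2 : 0 < z - y := by linarith
  rw [eq_div_iff a1.ne'] at e1
  rw [eq_div_iff a2.ne'] at e2
  rw [← e1, ← e2]
  have a3 : 0 < (y - x) * (z - y) := mul_pos a1 a2
  constructor <;> nlinarith

lemma sdiffeo_cr {φ : ℝ → ℝ} (h : IsSDiffeo φ) : CRx φ 0 1 := by
  set g : ℝ → ℝ := fun x => Real.exp (-(1 / 2) * Real.log (deriv φ x)) with hgdef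
  have hg : ∀ x ∈ Ioo (0:ℝ) 1, 0 < g x := fun x _ => Real.exp_pos _
  have hgd : ∀ x ∈ Ioo (0:ℝ) 1, HasDerivAt g (g x * (-(1 / 2) * nonlinearity φ x)) x :=
    fun x hx => ((sdiffeo_log h hx).const_mul (-(1 / 2))).exp
  have hNd : ∀ x ∈ Ioo (0:ℝ) 1, DifferentiableAt ℝ (nonlinearity φ) x := by
    intro x hx
    have h1 : DifferentiableAt ℝ (deriv φ) x :=
      ((sdiffeo_d1 h).contDiffAt (isOpen_Ioo.mem_nhds hx)).differentiableAt (by norm_num)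
    have h2 : DifferentiableAt ℝ (deriv (deriv φ)) x :=
      ((sdiffeo_d2 h).contDiffAt (isOpen_Ioo.mem_nhds hx)).differentiableAt (by norm_num)
    exact h2.div h1 (h.derivPos x (Ioo_subset_Icc_self hx)).ne'
  have hgdd : ∀ x ∈ Ioo (0:ℝ) 1, HasDerivAt (deriv g) (-(1 / 2) * g x * schwarzian φ x) x := by
    intro x hx
    have h1 := (hgd x hx).mul (((hNd x hx).hasDerivAt).const_mul (-(1 / 2)))
    have h2 : HasDerivAt (fun x => g x * (-(1 / 2) * nonlinearity φ x))
        (-(1 / 2) * g x * schwarzian φ x) x := by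
      refine h1.congr_deriv ?_
      unfold schwarzian; ring
    refine h2.congr_of_eventuallyEq ?_
    filter_upwards [isOpen_Ioo.mem_nhds hx] with y hy using (hgd y hy).deriv
  apply cr_closed (by norm_num) hg _ _ h.contDiff.continuousOn
  · intro x hx
    refine (sdiffeo_diffAt h (Ioo_subset_Icc_self hx)).hasDerivAt.congr_deriv ?_
    have p := h.derivPos x (Ioo_subset_Icc_self hx)
    have : g x ^ 2 = (deriv φ x)⁻¹ := by
      rw [hgdef, ← Real.exp_nat_mul]
      have : ((2:ℕ):ℝ) * (-(1 / 2) * Real.log (deriv φ x)) = -Real.log (deriv φ x) := by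
        push_cast; ring
      rw [this, Real.exp_neg, Real.exp_log p]
    rw [this]; simp
  · apply convexOn_of_deriv2_nonneg' (convex_Ioo 0 1)
    · exact fun x hx => (hgd x hx).differentiableAt.differentiableWithinAt
    · exact fun x hx => (hgdd x hx).differentiableAt.differentiableWithinAt
    · intro x hx
      simp only [iterate_succ, iterate_zero, comp, id]
      rw [(hgdd x hx).deriv]
      have := h.schwNonpos x (Ioo_subset_Icc_self hx)
      have := hg x hx
      nlinarith

lemma DPx.mono {K K' : ℝ} {φ : ℝ → ℝ} (hK : K ≤ K') (hm : StrictMonoOn φ (Icc 0 1)) (h : DPx K φ) :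
    DPx K' φ := by
  intro x y z hx hxy hyz hz
  have h1 : φ x ≤ φ y := hm.monotoneOn ⟨hx, by linarith⟩ ⟨by linarith, by linarith⟩ hxy
  have h2 : φ y ≤ φ z := hm.monotoneOn ⟨by linarith, by linarith⟩ ⟨by linarith, by linarith⟩ hyz
  obtain ⟨a, b⟩ := h x y z hx hxy hyz hz
  refine ⟨a.trans ?_, b.trans ?_⟩
  · exact mul_le_mul_of_nonneg_right hK (mul_nonneg (by linarith) (by linarith))
  · exact mul_le_mul_of_nonneg_right hK (mul_nonneg (by linarith) (by linarith))

lemma sdiffeo_weak {φ : ℝ → ℝ} (h : IsSDiffeo φ) {δ K : ℝ} (hδ : diffeoNorm φ < δ)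
    (hK : Real.exp δ ≤ K) : Weak K φ where
  mono := sdiffeo_mono h
  cont := h.contDiff.continuousOn
  z0 := h.fix0
  z1 := h.fix1
  cr := sdiffeo_cr h
  dp := (sdiffeo_dp h hδ).mono hK (sdiffeo_mono h)

lemma Weak.refl {K : ℝ} {φ : ℝ → ℝ} (h : Weak K φ) : Weak K (fun x => 1 - φ (1 - x)) where
  mono := by
    intro x hx y hy hxy
    have := h.mono (show 1 - y ∈ Icc (0:ℝ) 1 from ⟨by linarith [hy.2], by linarith [hy.1]⟩)
      (show 1 - x ∈ Icc (0:ℝ) 1 from ⟨by linarith [hx.2], by linarith [hx.1]⟩) (by linarith)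
    simp only; linarith
  cont := by
    apply continuousOn_const.sub
    apply h.cont.comp (by fun_prop)
    intro x hx; exact ⟨by linarith [hx.2], by linarith [hx.1]⟩
  z0 := by simp [h.z1]
  z1 := by simp [h.z0]
  cr := by
    intro p x y q h1 h2 h3 h4 h5
    have := h.cr (1 - q) (1 - y) (1 - x) (1 - p) (by linarith) (by linarith) (by linarith)
      (by linarith) (by linarith)
    simp only
    nlinarith
  dp := by
    intro x y z h1 h2 h3 h4
    obtain ⟨a, b⟩ := h.dp (1 - z) (1 - y) (1 - x) (by linarith) (by linarith) (by linarith)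
      (by linarith)
    simp only
    constructor <;> nlinarith

end

noncomputable section

lemma CRx.comp {h k : ℝ → ℝ} {A B A' B' : ℝ} (hh : CRx h A B) (hm : StrictMonoOn h (Icc A B))
    (hk : CRx k A' B') (km : StrictMonoOn k (Icc A' B')) (hmap : MapsTo h (Icc A B) (Icc A' B')) :
    CRx (fun x => k (h x)) A B := by
  intro p x y q h1 h2 h3 h4 h5
  rcases h2.eq_or_lt with rfl | h2
  · simp
  rcases h3.eq_or_lt with rfl | h3
  · simp
  rcases h4.eq_or_lt with rfl | h4
  · simp
  have mp : p ∈ Icc A B := ⟨by linarith, by linarith⟩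
  have mx : x ∈ Icc A B := ⟨by linarith, by linarith⟩
  have my : y ∈ Icc A B := ⟨by linarith, by linarith⟩
  have mq : q ∈ Icc A B := ⟨by linarith, by linarith⟩
  have i1 := hm mp mx h2
  have i2 := hm mx my h3
  have i3 := hm my mq h4
  have j1 := km (hmap mp) (hmap mx) i1
  have j2 := km (hmap mx) (hmap my) i2
  have j3 := km (hmap my) (hmap mq) i3
  have c1 := hh p x y q h1 h2.le h3.le h4.le h5
  have c2 := hk (h p) (h x) (h y) (h q) (hmap mp).1 i1.le i2.le i3.le (hmap mq).2
  have z1 : 0 < (h y - h x) * (h q - h p) := mul_pos (by linarith) (by linarith)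
  have z2 : 0 ≤ (k (h y) - k (h x)) * (k (h q) - k (h p)) := mul_nonneg (by linarith) (by linarith)
  have z3 : 0 ≤ (y - x) * (q - p) := mul_nonneg (by linarith) (by linarith)
  refine le_of_mul_le_mul_right ?_ z1
  calc _ = ((k (h x) - k (h p)) * (k (h q) - k (h y)) * ((h y - h x) * (h q - h p)))
              * ((y - x) * (q - p)) := by ring
    _ ≤ ((k (h y) - k (h x)) * (k (h q) - k (h p)) * ((h x - h p) * (h q - h y)))
              * ((y - x) * (q - p)) := mul_le_mul_of_nonneg_right c2 z3
    _ = (k (h y) - k (h x)) * (k (h q) - k (h p)) *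
          ((h x - h p) * (h q - h y) * ((y - x) * (q - p))) := by ring
    _ ≤ (k (h y) - k (h x)) * (k (h q) - k (h p)) *
          ((h y - h x) * (h q - h p) * ((x - p) * (q - y))) := mul_le_mul_of_nonneg_left c1 z2
    _ = _ := by ring

/-- The left half of a Lorenz map with weakly regular diffeomorphic part. -/
def HalfL (α K c : ℝ) (fm : ℝ → ℝ) : Prop :=
  ∃ (u : ℝ) (φ : ℝ → ℝ), 0 < u ∧ u ≤ 1 ∧ Weak K φ ∧
    ∀ x ∈ Icc 0 c, fm x = φ (u * (1 - ((c - x) / c) ^ α))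

/-- The model power branch -/
def qm (α u c x : ℝ) : ℝ := u * (1 - ((c - x) / c) ^ α)

section
variable {α u c : ℝ}

lemma w_mem (hc : 0 < c) {x : ℝ} (hx : x ∈ Icc 0 c) : (c - x) / c ∈ Icc (0:ℝ) 1 :=
  ⟨div_nonneg (by linarith [hx.2]) hc.le, (div_le_one hc).2 (by linarith [hx.1])⟩

lemma qm_mono (hα : 1 < α) (hu : 0 < u) (hc : 0 < c) : StrictMonoOn (qm α u c) (Icc 0 c) := by
  intro x hx y hy hxy
  have h1 : (c - y) / c < (c - x) / c := by gcongr
  have h2 := Real.rpow_lt_rpow (w_mem hc hy).1 h1 (by linarith : 0 < α)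
  unfold qm
  exact mul_lt_mul_of_pos_left (by linarith) hu

lemma qm_zero (hc : 0 < c) : qm α u c 0 = 0 := by
  unfold qm; rw [sub_zero, div_self hc.ne', Real.one_rpow]; simp

lemma qm_c (hα : 1 < α) : qm α u c c = u := by
  unfold qm; rw [sub_self, zero_div, Real.zero_rpow (by linarith)]; simp

lemma qm_mem (hα : 1 < α) (hu : 0 < u) (hc : 0 < c) {x : ℝ} (hx : x ∈ Icc 0 c) :
    qm α u c x ∈ Icc 0 u := by
  have m := (qm_mono hα hu hc).monotoneOn
  constructor
  · rw [← qm_zero (α := α) (u := u) hc]; exact m ⟨le_rfl, hc.le⟩ hx hx.1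
  · nth_rw 2 [← qm_c (α := α) (u := u) (c := c) hα]; exact m hx ⟨hc.le, le_rfl⟩ hx.2

lemma qm_cont (hα : 1 < α) : Continuous (qm α u c) := by
  unfold qm
  apply continuous_const.mul
  apply continuous_const.sub
  exact (Real.continuous_rpow_const (by linarith)).comp (by fun_prop)

lemma qm_cr (hα : 1 < α) (hc : 0 < c) : CRx (qm α u c) 0 c := by
  intro p x y q h1 h2 h3 h4 h5
  have := cr_rpow hα ((c - q) / c) ((c - y) / c) ((c - x) / c) ((c - p) / c)
    (div_nonneg (by linarith) hc.le) (by gcongr) (by gcongr) (by gcongr)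
    ((div_le_one hc).2 (by linarith))
  simp only at this
  have e1 : (c - x) / c - (c - y) / c = (y - x) / c := by ring
  have e2 : (c - p) / c - (c - q) / c = (q - p) / c := by ring
  have e3 : (c - y) / c - (c - q) / c = (q - y) / c := by ring
  have e4 : (c - p) / c - (c - x) / c = (x - p) / c := by ring
  rw [e1, e2, e3, e4] at this
  unfold qm
  generalize ((c - q) / c) ^ α = Q at *
  generalize ((c - y) / c) ^ α = Y at *
  generalize ((c - x) / c) ^ α = X at *
  generalize ((c - p) / c) ^ α = P at *
  have h6 := mul_le_mul_of_nonneg_left this (mul_nonneg (sq_nonneg u) (sq_nonneg c))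
  have h7 : u ^ 2 * c ^ 2 * ((Y - Q) * (P - X) * ((y - x) / c * ((q - p) / c))) =
    u ^ 2 * ((Y - Q) * (P - X) * ((y - x) * (q - p))) := by field_simp
  have h8 : u ^ 2 * c ^ 2 * ((X - Y) * (P - Q) * ((q - y) / c * ((x - p) / c))) =
    u ^ 2 * ((X - Y) * (P - Q) * ((q - y) * (x - p))) := by field_simp
  rw [h7, h8] at h6
  nlinarith

end

/-- lower Bernoulli for differences of powers -/
lemma pow_diff_lower {α s t : ℝ} (hα : 1 < α) (hs : 0 < s) (hst : s ≤ t) :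
    α * s ^ (α - 1) * (t - s) ≤ t ^ α - s ^ α := by
  have h := one_add_mul_self_le_rpow_one_add (s := t / s - 1) (p := α) (by
    have : 0 ≤ t / s := div_nonneg (by linarith) hs.le
    linarith) hα.le
  rw [show 1 + (t / s - 1) = t / s by ring, Real.div_rpow (by linarith) hs.le,
    le_div_iff₀ (Real.rpow_pos_of_pos hs α)] at h
  have e : s ^ α = s ^ (α - 1) * s := by
    rw [← Real.rpow_add_one hs.ne']; congr 1; ring
  have e2 : (1 + α * (t / s - 1)) * s ^ α = s ^ α + α * s ^ (α - 1) * (t - s) := by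
    rw [e]; field_simp
  linarith

lemma pow_diff_upper {α s t : ℝ} (hα : 1 < α) (hs : 0 ≤ s) (hst : s ≤ t) (ht : t ≤ 1) :
    t ^ α - s ^ α ≤ α * (t - s) := by
  rcases hs.eq_or_lt with rfl | hs0
  · rcases hst.eq_or_lt with rfl | ht0
    · simp
    rw [Real.zero_rpow (by linarith)]
    have := Real.rpow_le_rpow_of_exponent_ge ht0 ht hα.le
    rw [Real.rpow_one] at this
    nlinarith
  have ht0 : 0 < t := by linarith
  have h := one_add_mul_self_le_rpow_one_add (s := s / t - 1) (p := α) (by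
    have : 0 ≤ s / t := div_nonneg (by linarith) ht0.le
    linarith) hα.le
  rw [show 1 + (s / t - 1) = s / t by ring, Real.div_rpow (by linarith) ht0.le,
    le_div_iff₀ (Real.rpow_pos_of_pos ht0 α)] at h
  have e : t ^ α = t ^ (α - 1) * t := by
    rw [← Real.rpow_add_one ht0.ne']; congr 1; ring
  have e2 : (1 + α * (s / t - 1)) * t ^ α = t ^ α - α * t ^ (α - 1) * (t - s) := by
    rw [e]; field_simp; ring
  have e3 : t ^ (α - 1) ≤ 1 := Real.rpow_le_one ht0.le ht (by linarith)
  have : α * t ^ (α - 1) * (t - s) ≤ α * 1 * (t - s) := by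
    apply mul_le_mul_of_nonneg_right _ (by linarith)
    exact mul_le_mul_of_nonneg_left e3 (by linarith)
  linarith

namespace HalfL
variable {α K c : ℝ} {fm : ℝ → ℝ}

lemma strictMono (h : HalfL α K c fm) (hα : 1 < α) (hc : 0 < c) : StrictMonoOn fm (Icc 0 c) := by
  obtain ⟨u, φ, hu, hu1, hw, hf⟩ := h
  intro x hx y hy hxy
  rw [hf x hx, hf y hy]
  have a := qm_mem hα hu hc hx
  have b := qm_mem hα hu hc hy
  exact hw.mono ⟨a.1, a.2.trans hu1⟩ ⟨b.1, b.2.trans hu1⟩ (qm_mono hα hu hc hx hy hxy)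

lemma cont (h : HalfL α K c fm) (hα : 1 < α) (hc : 0 < c) : ContinuousOn fm (Icc 0 c) := by
  obtain ⟨u, φ, hu, hu1, hw, hf⟩ := h
  have : ContinuousOn (fun x => φ (qm α u c x)) (Icc 0 c) := by
    apply hw.cont.comp (qm_cont hα).continuousOn
    intro x hx
    have a := qm_mem hα hu hc hx
    exact ⟨a.1, a.2.trans hu1⟩
  exact this.congr hf

lemma zero (h : HalfL α K c fm) (hc : 0 < c) : fm 0 = 0 := by
  obtain ⟨u, φ, hu, hu1, hw, hf⟩ := h
  rw [hf 0 ⟨le_rfl, hc.le⟩]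
  exact (congrArg φ (qm_zero hc)).trans hw.z0

lemma le_one (h : HalfL α K c fm) (hα : 1 < α) (hc : 0 < c) : fm c ≤ 1 := by
  obtain ⟨u, φ, hu, hu1, hw, hf⟩ := h
  rw [hf c ⟨hc.le, le_rfl⟩]
  have a := qm_mem hα hu hc (show c ∈ Icc 0 c from ⟨hc.le, le_rfl⟩)
  have t := hw.mono.monotoneOn ⟨a.1, a.2.trans hu1⟩ ⟨by norm_num, le_rfl⟩ (a.2.trans hu1)
  rw [hw.z1] at t
  exact t

lemma cr (h : HalfL α K c fm) (hα : 1 < α) (hc : 0 < c) : CRx fm 0 c := by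
  obtain ⟨u, φ, hu, hu1, hw, hf⟩ := h
  have : CRx (fun x => φ (qm α u c x)) 0 c := by
    apply (qm_cr hα hc).comp (qm_mono hα hu hc) hw.cr hw.mono
    intro x hx
    have a := qm_mem hα hu hc hx
    exact ⟨a.1, a.2.trans hu1⟩
  intro p x y q h1 h2 h3 h4 h5
  have := this p x y q h1 h2 h3 h4 h5
  rw [hf p ⟨by linarith, by linarith⟩, hf x ⟨by linarith, by linarith⟩,
    hf y ⟨by linarith, by linarith⟩, hf q ⟨by linarith, by linarith⟩]
  exact this

/-- The basic distortion inequalities, from which everything else follows. -/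
lemma basic (h : HalfL α K c fm) (hα : 1 < α) (hc : 0 < c) {x y : ℝ} (hx : 0 ≤ x) (hxy : x ≤ y)
    (hy : y ≤ c) :
    (fm c - fm y) * (((c - x) / c) ^ α - ((c - y) / c) ^ α) ≤
      K * ((fm y - fm x) * ((c - y) / c) ^ α) ∧
    (fm y - fm x) * ((c - y) / c) ^ α ≤
      K * ((fm c - fm y) * (((c - x) / c) ^ α - ((c - y) / c) ^ α)) := by
  obtain ⟨u, φ, hu, hu1, hw, hf⟩ := h
  have m := (qm_mono hα hu hc).monotoneOn
  have mx : x ∈ Icc 0 c := ⟨hx, by linarith⟩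
  have my : y ∈ Icc 0 c := ⟨by linarith, by linarith⟩
  have a := qm_mem hα hu hc mx
  have b := qm_mem hα hu hc my
  have d := hw.dp (qm α u c x) (qm α u c y) u a.1 (m mx my hxy) b.2 hu1
  have ec : fm c = φ u := by rw [hf c ⟨hc.le, le_rfl⟩]; exact congrArg φ (qm_c hα)
  have ex : fm x = φ (qm α u c x) := hf x mx
  have ey : fm y = φ (qm α u c y) := hf y my
  rw [← ec, ← ex, ← ey] at d
  have e1 : u - qm α u c y = u * ((c - y) / c) ^ α := by unfold qm; ring
  have e2 : qm α u c y - qm α u c x = u * (((c - x) / c) ^ α - ((c - y) / c) ^ α) := by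
    unfold qm; ring
  rw [e1, e2] at d
  obtain ⟨d1, d2⟩ := d
  constructor
  · refine le_of_mul_le_mul_left ?_ hu
    nlinarith
  · refine le_of_mul_le_mul_left ?_ hu
    nlinarith

lemma basic0 (h : HalfL α K c fm) (hα : 1 < α) (hc : 0 < c) {x : ℝ} (hx : 0 ≤ x) (hy : x ≤ c) :
    (fm c - fm x) * (1 - ((c - x) / c) ^ α) ≤ K * (fm x * ((c - x) / c) ^ α) ∧
    fm x * ((c - x) / c) ^ α ≤ K * ((fm c - fm x) * (1 - ((c - x) / c) ^ α)) := by
  have := h.basic hα hc le_rfl hx hy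
  rw [h.zero hc, sub_zero, div_self hc.ne', Real.one_rpow, sub_zero] at this
  exact this

lemma nonneg (h : HalfL α K c fm) (hα : 1 < α) (hc : 0 < c) {x : ℝ} (hx : 0 ≤ x) (hy : x ≤ c) :
    0 ≤ fm x := by
  rw [← h.zero hc]
  exact (h.strictMono hα hc).monotoneOn ⟨le_rfl, hc.le⟩ ⟨hx, hy⟩ hx

lemma le_top (h : HalfL α K c fm) (hα : 1 < α) (hc : 0 < c) {x : ℝ} (hx : 0 ≤ x) (hy : x ≤ c) :
    fm x ≤ fm c :=
  (h.strictMono hα hc).monotoneOn ⟨hx, hy⟩ ⟨hc.le, le_rfl⟩ hy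

lemma odds (h : HalfL α K c fm) (hα : 1 < α) (hc : 0 < c) {x : ℝ} (hx : 0 ≤ x) (hy : x ≤ c) :
    α * ((fm c - fm x) * x) ≤ K * (fm x * (c - x)) := by
  rcases hy.eq_or_lt with rfl | hlt
  · simp
  have b := (h.basic0 hα hc hx hy).1
  have t := h.le_top hα hc hx hy
  set w := (c - x) / c with hw
  have w0 : 0 < w := div_pos (by linarith) hc
  have w1 : w ≤ 1 := (w_mem hc ⟨hx, hy⟩).2
  have p := pow_diff_lower hα w0 w1
  rw [Real.one_rpow] at p
  have e : w ^ α = w ^ (α - 1) * w := by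
    rw [← Real.rpow_add_one w0.ne']; congr 1; ring
  have pp := Real.rpow_pos_of_pos w0 (α - 1)
  have h1 : α * ((fm c - fm x) * (1 - w)) ≤ K * (fm x * w) := by
    refine le_of_mul_le_mul_left ?_ pp
    have := mul_le_mul_of_nonneg_left p (sub_nonneg.2 t)
    rw [e] at b this
    nlinarith
  have e1 : c - x = c * w := by rw [hw]; field_simp
  have e2 : x = c * (1 - w) := by linarith
  calc _ = c * (α * ((fm c - fm x) * (1 - w))) := by rw [mul_comm (fm c - fm x) x]; nth_rw 1 [e2]; ring
    _ ≤ c * (K * (fm x * w)) := mul_le_mul_of_nonneg_left h1 hc.le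
    _ = _ := by rw [e1]; ring

lemma wpow_le (hα : 1 < α) (hc : 0 < c) {x : ℝ} (hx : 0 ≤ x) (hy : x ≤ c) :
    ((c - x) / c) ^ α ≤ (c - x) / c := by
  have m := w_mem hc ⟨hx, hy⟩
  rcases m.1.eq_or_lt with h0 | h0
  · rw [← h0, Real.zero_rpow (by linarith)]
  have := Real.rpow_le_rpow_of_exponent_ge h0 m.2 hα.le
  rwa [Real.rpow_one] at this

lemma linLower (h : HalfL α K c fm) (hα : 1 < α) (hK : 1 ≤ K) (hc : 0 < c) {x : ℝ} (hx : 0 ≤ x)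
    (hy : x ≤ c) : fm c * x ≤ K * c * fm x := by
  have b := (h.basic0 hα hc hx hy).1
  have n := h.nonneg hα hc hx hy
  have n2 := h.nonneg hα hc hc.le le_rfl
  have p := wpow_le hα hc hx hy
  have w0 : 0 ≤ ((c - x) / c) ^ α := Real.rpow_nonneg (w_mem hc ⟨hx, hy⟩).1 _
  have w1 : ((c - x) / c) ^ α ≤ 1 := p.trans (w_mem hc ⟨hx, hy⟩).2
  have h1 : fm c * (1 - ((c - x) / c) ^ α) ≤ K * fm x := by
    have : fm x * (1 - ((c - x) / c) ^ α) ≤ K * (fm x * (1 - ((c - x) / c) ^ α)) :=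
      le_mul_of_one_le_left (mul_nonneg n (by linarith)) hK
    nlinarith
  have h2 : fm c * (1 - (c - x) / c) ≤ fm c * (1 - ((c - x) / c) ^ α) :=
    mul_le_mul_of_nonneg_left (by linarith) n2
  have e : c * (1 - (c - x) / c) = x := by field_simp; ring
  calc fm c * x = c * (fm c * (1 - (c - x) / c)) := by rw [mul_left_comm, e]
    _ ≤ c * (K * fm x) := mul_le_mul_of_nonneg_left (h2.trans h1) hc.le
    _ = _ := by ring

lemma topUpper (h : HalfL α K c fm) (hα : 1 < α) (hK : 1 ≤ K) (hc : 0 < c) {x : ℝ} (hx : 0 ≤ x)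
    (hy : x ≤ c) : fm c - fm x ≤ K * (fm c * ((c - x) / c) ^ α) := by
  have b := (h.basic0 hα hc hx hy).1
  have t := h.le_top hα hc hx hy
  have w0 : 0 ≤ ((c - x) / c) ^ α := Real.rpow_nonneg (w_mem hc ⟨hx, hy⟩).1 _
  have : (fm c - fm x) * ((c - x) / c) ^ α ≤ K * ((fm c - fm x) * ((c - x) / c) ^ α) :=
    le_mul_of_one_le_left (mul_nonneg (by linarith) w0) hK
  nlinarith

lemma topLower (h : HalfL α K c fm) (hα : 1 < α) (hK : 1 ≤ K) (hc : 0 < c) {x : ℝ} (hx : 0 ≤ x)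
    (hy : x ≤ c) : fm c * ((c - x) / c) ^ α ≤ K * (fm c - fm x) := by
  have b := (h.basic0 hα hc hx hy).2
  have t := h.le_top hα hc hx hy
  have w0 : 0 ≤ ((c - x) / c) ^ α := Real.rpow_nonneg (w_mem hc ⟨hx, hy⟩).1 _
  have : (fm c - fm x) * ((c - x) / c) ^ α ≤ K * ((fm c - fm x) * ((c - x) / c) ^ α) :=
    le_mul_of_one_le_left (mul_nonneg (by linarith) w0) hK
  nlinarith

lemma lip (h : HalfL α K c fm) (hα : 1 < α) (hK : 1 ≤ K) (hc : 0 < c) {x y : ℝ} (hx : 0 ≤ x)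
    (hxy : x ≤ y) (hy : y ≤ c) : c * (fm y - fm x) ≤ K * α * (y - x) := by
  obtain ⟨u, φ, hu, hu1, hw, hf⟩ := id h
  have m := (qm_mono hα hu hc).monotoneOn
  have mx : x ∈ Icc 0 c := ⟨hx, by linarith⟩
  have my : y ∈ Icc 0 c := ⟨by linarith, by linarith⟩
  have a := qm_mem hα hu hc mx
  have b := qm_mem hα hu hc my
  have mm := m mx my hxy
  have ec : fm c = φ u := by rw [hf c ⟨hc.le, le_rfl⟩]; exact congrArg φ (qm_c hα)
  have ex : fm x = φ (qm α u c x) := hf x mx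
  have ey : fm y = φ (qm α u c y) := hf y my
  have d1 := (hw.dp (qm α u c x) (qm α u c y) u a.1 mm b.2 hu1).1
  have d2 := (hw.dp 0 (qm α u c x) (qm α u c y) le_rfl a.1 mm (b.2.trans hu1)).2
  rw [← ec, ← ex, ← ey] at d1
  rw [hw.z0, ← ex, ← ey] at d2
  have e2 : qm α u c y - qm α u c x = u * (((c - x) / c) ^ α - ((c - y) / c) ^ α) := by
    unfold qm; ring
  have p := pow_diff_upper hα (w_mem hc my).1
    (show (c - y) / c ≤ (c - x) / c by gcongr) (w_mem hc mx).2
  have inc : fm x ≤ fm y := (h.strictMono hα hc).monotoneOn mx my hxy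
  have l1 := h.le_one hα hc
  have h3 : (fm y - fm x) * u ≤ K * (fm c * (qm α u c y - qm α u c x)) := by
    have : (fm y - fm x) * (qm α u c y - qm α u c x) ≤
      K * ((fm y - fm x) * (qm α u c y - qm α u c x)) :=
      le_mul_of_one_le_left (mul_nonneg (by linarith) (by linarith)) hK
    nlinarith
  have h4 : K * (fm c * (qm α u c y - qm α u c x)) ≤ K * (1 * (qm α u c y - qm α u c x)) := by
    apply mul_le_mul_of_nonneg_left _ (by linarith)
    exact mul_le_mul_of_nonneg_right l1 (by linarith)
  rw [e2] at h3 h4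
  have h5 : fm y - fm x ≤ K * (((c - x) / c) ^ α - ((c - y) / c) ^ α) := by
    refine le_of_mul_le_mul_left ?_ hu
    nlinarith
  have e : α * ((c - x) / c - (c - y) / c) = α * (y - x) / c := by ring
  have h6 : fm y - fm x ≤ K * (α * (y - x) / c) := h5.trans (by
    rw [← e]; exact mul_le_mul_of_nonneg_left p (by linarith))
  calc _ ≤ c * (K * (α * (y - x) / c)) := mul_le_mul_of_nonneg_left h6 hc.le
    _ = _ := by field_simp

lemma logExp (h : HalfL α K c fm) (hα : 1 < α) (hK : 1 ≤ K) (hc : 0 < c) {x y : ℝ} (hx : 0 ≤ x)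
    (hxy : x ≤ y) (hy : y < c) :
    α / K * (Real.log (c - x) - Real.log (c - y)) ≤
      Real.log (fm c - fm x) - Real.log (fm c - fm y) := by
  have b := (h.basic hα hc hx hxy hy.le).1
  have sm := h.strictMono hα hc
  have t1 : fm y < fm c := sm ⟨by linarith, hy.le⟩ ⟨hc.le, le_rfl⟩ hy
  have t2 : fm x ≤ fm y := sm.monotoneOn ⟨by linarith, by linarith⟩ ⟨by linarith, hy.le⟩ hxy
  have wy : 0 < (c - y) / c := div_pos (by linarith) hc
  have wx : 0 < (c - x) / c := div_pos (by linarith) hc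
  have P := Real.rpow_pos_of_pos wy α
  have cx : 0 < c - x := by linarith
  have cy : 0 < c - y := by linarith
  have r0 : 0 < (c - x) / (c - y) := by positivity
  have ratio : ((c - x) / c) ^ α / ((c - y) / c) ^ α = ((c - x) / (c - y)) ^ α := by
    rw [← Real.div_rpow wx.le wy.le]; congr 1; field_simp
  rw [← Real.log_div (by linarith) (by linarith), ← Real.log_div (by linarith) (by linarith),
    ← Real.log_rpow r0]
  apply Real.log_le_log (by positivity)
  have Kp : 0 < K := by linarith
  have B := rpow_one_add_le_one_add_mul_self (s := ((c - x) / (c - y)) ^ α - 1) (p := 1 / K)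
    (by have := Real.rpow_pos_of_pos r0 α; linarith) (by positivity) ((div_le_one Kp).2 hK)
  rw [show 1 + (((c - x) / (c - y)) ^ α - 1) = ((c - x) / (c - y)) ^ α by ring,
    ← Real.rpow_mul r0.le, mul_one_div] at B
  refine B.trans ?_
  rw [← ratio, le_div_iff₀ (by linarith)]
  have e : (1 + 1 / K * (((c - x) / c) ^ α / ((c - y) / c) ^ α - 1)) * (fm c - fm y) =
    (fm c - fm y) + ((fm c - fm y) * (((c - x) / c) ^ α - ((c - y) / c) ^ α)) /
      (K * ((c - y) / c) ^ α) := by field_simp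
  rw [e]
  have : ((fm c - fm y) * (((c - x) / c) ^ α - ((c - y) / c) ^ α)) / (K * ((c - y) / c) ^ α) ≤
    fm y - fm x := by
    rw [div_le_iff₀ (by positivity)]; linarith
  linarith

end HalfL

end

noncomputable section

/-- Conjugation of a map by the reflection `x ↦ 1 - x`. -/
def Dl (f : ℝ → ℝ) : ℝ → ℝ := fun x => 1 - f (1 - x)

lemma Dl_Dl (f : ℝ → ℝ) : Dl (Dl f) = f := by
  funext x; simp [Dl]

lemma Dl_apply (f : ℝ → ℝ) (x : ℝ) : Dl f x = 1 - f (1 - x) := rfl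

lemma Dl_iter (f : ℝ → ℝ) (n : ℕ) (x : ℝ) : (Dl f)^[n] x = 1 - f^[n] (1 - x) := by
  induction n generalizing x with
  | zero => simp
  | succ n ih =>
    rw [iterate_succ_apply, iterate_succ_apply, ih]
    simp [Dl]

lemma CRx.dual {h : ℝ → ℝ} {A B : ℝ} (hh : CRx h A B) : CRx (Dl h) (1 - B) (1 - A) := by
  intro p x y q h1 h2 h3 h4 h5
  have := hh (1 - q) (1 - y) (1 - x) (1 - p) (by linarith) (by linarith) (by linarith)
    (by linarith) (by linarith)
  unfold Dl
  nlinarith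

/-- Abstract Lorenz systems with weak distortion control. -/
structure Sys (α K c : ℝ) (fm fp : ℝ → ℝ) : Prop where
  c0 : 0 < c
  c1 : c < 1
  L : HalfL α K c fm
  R : HalfL α K (1 - c) (Dl fp)
  left : ∀ x ∈ Ioc 0 c, x < fm x
  right : ∀ x ∈ Ico c 1, fp x < x

/-- Basic properties of Lorenz maps. -/
structure Bas (c : ℝ) (fm fp : ℝ → ℝ) : Prop where
  c0 : 0 < c
  c1 : c < 1
  left : ∀ x ∈ Ioc 0 c, x < fm x
  right : ∀ x ∈ Ico c 1, fp x < x
  z0 : fm 0 = 0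
  z1 : fp 1 = 1
  top : fm c ≤ 1
  bot : 0 ≤ fp c
  contL : ContinuousOn fm (Icc 0 c)
  contR : ContinuousOn fp (Icc c 1)

/-- Renormalization data. -/
structure RenData (c : ℝ) (fm fp : ℝ → ℝ) (gc : ℝ) (gm gp : ℝ → ℝ) (a b : ℕ) (l r : ℝ) : Prop where
  l0 : 0 ≤ l
  lc : l < c
  cr : c < r
  r1 : r ≤ 1
  gc_eq : gc = (c - l) / (r - l)
  oL : ∀ i < a, c < fp^[i] (fm l)
  oR : ∀ i < b, fm^[i] (fp r) < c
  eL : ∀ x ∈ Icc l c, l + (r - l) * gm ((x - l) / (r - l)) = fp^[a] (fm x)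
  eR : ∀ x ∈ Icc c r, l + (r - l) * gp ((x - l) / (r - l)) = fm^[b] (fp x)

lemma refl_cont {f : ℝ → ℝ} {a b : ℝ} (h : ContinuousOn f (Icc a b)) :
    ContinuousOn (Dl f) (Icc (1 - b) (1 - a)) := by
  apply continuousOn_const.sub
  apply h.comp (by fun_prop)
  intro x hx
  exact ⟨by linarith [hx.2], by linarith [hx.1]⟩

lemma Sys.dual {α K c : ℝ} {fm fp : ℝ → ℝ} (S : Sys α K c fm fp) :
    Sys α K (1 - c) (Dl fp) (Dl fm) where
  c0 := by linarith [S.c1]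
  c1 := by linarith [S.c0]
  L := S.R
  R := by rw [Dl_Dl, sub_sub_cancel]; exact S.L
  left := by
    intro x hx
    have := S.right (1 - x) ⟨by linarith [hx.2], by linarith [hx.1]⟩
    rw [Dl_apply]; linarith
  right := by
    intro x hx
    have := S.left (1 - x) ⟨by linarith [hx.2], by linarith [hx.1]⟩
    rw [Dl_apply]; linarith

lemma Bas.dual {c : ℝ} {fm fp : ℝ → ℝ} (S : Bas c fm fp) : Bas (1 - c) (Dl fp) (Dl fm) where
  c0 := by linarith [S.c1]
  c1 := by linarith [S.c0]
  left := by
    intro x hx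
    have := S.right (1 - x) ⟨by linarith [hx.2], by linarith [hx.1]⟩
    rw [Dl_apply]; linarith
  right := by
    intro x hx
    have := S.left (1 - x) ⟨by linarith [hx.2], by linarith [hx.1]⟩
    rw [Dl_apply]; linarith
  z0 := by rw [Dl_apply, sub_zero, S.z1]; norm_num
  z1 := by rw [Dl_apply, sub_self, S.z0]; norm_num
  top := by rw [Dl_apply, sub_sub_cancel]; linarith [S.bot]
  bot := by rw [Dl_apply, sub_sub_cancel]; linarith [S.top]
  contL := by have := refl_cont S.contR; rwa [sub_self] at this
  contR := by have := refl_cont S.contL; rwa [sub_zero] at this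

lemma RenData.dual {c : ℝ} {fm fp : ℝ → ℝ} {gc : ℝ} {gm gp : ℝ → ℝ} {a b : ℕ} {l r : ℝ}
    (R : RenData c fm fp gc gm gp a b l r) :
    RenData (1 - c) (Dl fp) (Dl fm) (1 - gc) (Dl gp) (Dl gm) b a (1 - r) (1 - l) where
  l0 := by linarith [R.r1]
  lc := by linarith [R.cr]
  cr := by linarith [R.lc]
  r1 := by linarith [R.l0]
  gc_eq := by
    have : r - l ≠ 0 := by linarith [R.lc, R.cr]
    rw [R.gc_eq, show 1 - l - (1 - r) = r - l by ring]; field_simp; ring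
  oL := by
    intro i hi
    have := R.oR i hi
    rw [Dl_iter, Dl_apply, sub_sub_cancel, sub_sub_cancel]; linarith
  oR := by
    intro i hi
    have := R.oL i hi
    rw [Dl_iter, Dl_apply, sub_sub_cancel, sub_sub_cancel]; linarith
  eL := by
    intro x hx
    have := R.eR (1 - x) ⟨by linarith [hx.2], by linarith [hx.1]⟩
    have ne : r - l ≠ 0 := by linarith [R.lc, R.cr]
    rw [Dl_iter, Dl_apply, Dl_apply, sub_sub_cancel, ← this, show 1 - l - (1 - r) = r - l by ring,
      show 1 - (x - (1 - r)) / (r - l) = (1 - x - l) / (r - l) by field_simp; ring]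
    ring
  eR := by
    intro x hx
    have := R.eL (1 - x) ⟨by linarith [hx.2], by linarith [hx.1]⟩
    have ne : r - l ≠ 0 := by linarith [R.lc, R.cr]
    rw [Dl_iter, Dl_apply, Dl_apply, sub_sub_cancel, ← this, show 1 - l - (1 - r) = r - l by ring,
      show 1 - (x - (1 - r)) / (r - l) = (1 - x - l) / (r - l) by field_simp; ring]
    ring

section
variable {α K c : ℝ} {fm fp : ℝ → ℝ}

lemma Sys.fp_mono (S : Sys α K c fm fp) (hα : 1 < α) : StrictMonoOn fp (Icc c 1) := by
  intro x hx y hy hxy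
  have := S.R.strictMono hα (by linarith [S.c1])
    (show 1 - y ∈ Icc 0 (1 - c) from ⟨by linarith [hy.2], by linarith [hy.1]⟩)
    (show 1 - x ∈ Icc 0 (1 - c) from ⟨by linarith [hx.2], by linarith [hx.1]⟩) (by linarith)
  simp only [Dl_apply, sub_sub_cancel] at this
  linarith

lemma Sys.fp_cont (S : Sys α K c fm fp) (hα : 1 < α) : ContinuousOn fp (Icc c 1) := by
  have := refl_cont (S.R.cont hα (by linarith [S.c1]))
  rwa [Dl_Dl, sub_sub_cancel, sub_zero] at this

lemma Sys.fp_cr (S : Sys α K c fm fp) (hα : 1 < α) : CRx fp c 1 := by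
  have := (S.R.cr hα (by linarith [S.c1])).dual
  rwa [Dl_Dl, sub_sub_cancel, sub_zero] at this

lemma Sys.fp_one (S : Sys α K c fm fp) : fp 1 = 1 := by
  have := S.R.zero (by linarith [S.c1])
  rw [Dl_apply, sub_zero] at this
  linarith

lemma Sys.eps_nonneg (S : Sys α K c fm fp) (hα : 1 < α) : 0 ≤ fp c := by
  have := S.R.le_one hα (by linarith [S.c1])
  rw [Dl_apply, sub_sub_cancel] at this
  linarith

lemma Sys.iter (S : Sys α K c fm fp) (hα : 1 < α) (n : ℕ) {X : ℝ} (hX : X ≤ 1)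
    (ho : ∀ i < n, c ≤ fp^[i] X) :
    StrictMonoOn (fp^[n]) (Icc X 1) ∧ ContinuousOn (fp^[n]) (Icc X 1) ∧ CRx (fp^[n]) X 1 ∧
      fp^[n] 1 = 1 := by
  induction n with
  | zero =>
    refine ⟨fun x _ y _ h => h, continuousOn_id, ?_, rfl⟩
    intro p x y q h1 h2 h3 h4 h5
    simp only [iterate_zero, id]
    apply le_of_eq; ring
  | succ n ih =>
    obtain ⟨m, ct, cr, f1⟩ := ih (fun i hi => ho i (by omega))
    have maps : MapsTo (fp^[n]) (Icc X 1) (Icc c 1) := by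
      intro x hx
      refine ⟨(ho n (by omega)).trans (m.monotoneOn ⟨le_rfl, hX⟩ hx hx.1), ?_⟩
      have := m.monotoneOn hx ⟨hX, le_rfl⟩ hx.2
      rwa [f1] at this
    rw [iterate_succ']
    refine ⟨(S.fp_mono hα).comp m maps, (S.fp_cont hα).comp ct maps, ?_, ?_⟩
    · exact cr.comp m (S.fp_cr hα) (S.fp_mono hα) maps
    · rw [comp_apply, f1, S.fp_one]

lemma Sys.exists_pre (S : Sys α K c fm fp) (hα : 1 < α) (n : ℕ) :
    ∃ X, c ≤ X ∧ X < 1 ∧ (∀ i < n + 1, c ≤ fp^[i] X) ∧ fp^[n + 1] X = fp c := by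
  induction n with
  | zero =>
    refine ⟨c, le_rfl, S.c1, ?_, rfl⟩
    intro i hi
    have : i = 0 := by omega
    subst this; exact le_rfl
  | succ n ih =>
    obtain ⟨X, h1, h2, h3, h4⟩ := ih
    have := intermediate_value_Icc S.c1.le (S.fp_cont hα)
    have e := S.right c ⟨le_rfl, S.c1⟩
    obtain ⟨Y, hY, hYX⟩ := this (show X ∈ Icc (fp c) (fp 1) from
      ⟨by linarith, by rw [S.fp_one]; exact h2.le⟩)
    refine ⟨Y, hY.1, ?_, ?_, ?_⟩
    · refine lt_of_le_of_ne hY.2 ?_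
      rintro rfl
      rw [S.fp_one] at hYX; linarith
    · intro i hi
      rcases i with _ | i
      · exact hY.1
      · rw [iterate_succ_apply, hYX]; exact h3 i (by omega)
    · rw [iterate_succ_apply, hYX, h4]

end

/-- Koebe principle from cross-ratio expansion. -/
lemma koebe {h : ℝ → ℝ} {A m1 m2 B σ : ℝ} (hm : StrictMonoOn h (Icc A B))
    (hc : ContinuousOn h (Icc A B)) (hcr : CRx h A B)
    (h1 : A < m1) (h2 : m1 < m2) (h3 : m2 ≤ B) (hσ : 0 ≤ σ)
    (s1 : h m2 - h m1 ≤ σ * (h m1 - h A)) (s2 : h m2 - h m1 ≤ σ * (h B - h m2)) :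
    Weak (1 + σ) (fun z => (h (m1 + z * (m2 - m1)) - h m1) / (h m2 - h m1)) := by
  have M1 : m1 ∈ Icc A B := ⟨by linarith, by linarith⟩
  have M2 : m2 ∈ Icc A B := ⟨by linarith, by linarith⟩
  have MA : A ∈ Icc A B := ⟨by linarith, by linarith⟩
  have MB : B ∈ Icc A B := ⟨by linarith, by linarith⟩
  have D : 0 < h m2 - h m1 := sub_pos.2 (hm M1 M2 h2)
  have d : 0 < m2 - m1 := by linarith
  have hB : m2 < B := by
    refine lt_of_le_of_ne h3 ?_
    rintro rfl
    simp at s2; linarith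
  have mem : ∀ z ∈ Icc (0:ℝ) 1, m1 + z * (m2 - m1) ∈ Icc m1 m2 := by
    intro z hz
    constructor
    · nlinarith [hz.1, hz.2]
    · nlinarith [hz.1, hz.2]
  have memAB : ∀ z ∈ Icc (0:ℝ) 1, m1 + z * (m2 - m1) ∈ Icc A B := by
    intro z hz
    have := mem z hz
    exact ⟨by linarith [this.1], by linarith [this.2]⟩
  refine ⟨?_, ?_, ?_, ?_, ?_, ?_⟩
  · intro x hx y hy hxy
    have := hm (memAB x hx) (memAB y hy) (by nlinarith)
    simp only
    gcongr
  · apply ContinuousOn.div_const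
    apply ContinuousOn.sub _ continuousOn_const
    exact hc.comp (by fun_prop) (fun z hz => memAB z hz)
  · simp
  · simp only [one_mul]
    rw [show m1 + (m2 - m1) = m2 by ring, div_self D.ne']
  · intro p x y q i1 i2 i3 i4 i5
    have t : ∀ s t : ℝ, s ≤ t → m1 + s * (m2 - m1) ≤ m1 + t * (m2 - m1) := fun s t hst => by
      nlinarith
    have := hcr _ _ _ _ (memAB p ⟨i1, by linarith⟩).1 (t _ _ i2) (t _ _ i3) (t _ _ i4)
      (memAB q ⟨by linarith, i5⟩).2
    simp only
    generalize h (m1 + p * (m2 - m1)) = P at *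
    generalize h (m1 + x * (m2 - m1)) = X at *
    generalize h (m1 + y * (m2 - m1)) = Y at *
    generalize h (m1 + q * (m2 - m1)) = Q at *
    have e : ∀ U V W Z : ℝ, (U / (h m2 - h m1) - V / (h m2 - h m1)) *
        (W / (h m2 - h m1) - Z / (h m2 - h m1)) =
        (U - V) * (W - Z) / (h m2 - h m1) ^ 2 := by
      intro U V W Z; field_simp
    rw [e, e, div_mul_eq_mul_div, div_mul_eq_mul_div]
    apply div_le_div_of_nonneg_right _ (by positivity)
    have d2 : 0 < (m2 - m1) ^ 2 := by positivity
    refine le_of_mul_le_mul_right ?_ d2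
    linear_combination this
  · intro x y z i1 i2 i3 i4
    rcases i2.eq_or_lt with rfl | i2
    · simp
    rcases i3.eq_or_lt with rfl | i3
    · simp
    have mx := memAB x ⟨i1, by linarith⟩
    have my := memAB y ⟨by linarith, by linarith⟩
    have mz := memAB z ⟨by linarith, i4⟩
    have mx' := mem x ⟨i1, by linarith⟩
    have mz' := mem z ⟨by linarith, i4⟩
    have lxy : m1 + x * (m2 - m1) < m1 + y * (m2 - m1) := by nlinarith
    have lyz : m1 + y * (m2 - m1) < m1 + z * (m2 - m1) := by nlinarith
    have ey : y - x = ((m1 + y * (m2 - m1)) - (m1 + x * (m2 - m1))) / (m2 - m1) := by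
      field_simp; ring
    have ez : z - y = ((m1 + z * (m2 - m1)) - (m1 + y * (m2 - m1))) / (m2 - m1) := by
      field_simp; ring
    simp only
    rw [ey, ez]
    generalize m1 + x * (m2 - m1) = X at *
    generalize m1 + y * (m2 - m1) = Y at *
    generalize m1 + z * (m2 - m1) = Z at *
    have c1 := hcr A X Y Z le_rfl mx.1 lxy.le lyz.le mz.2
    have c2 := hcr X Y Z B mx.1 lxy.le lyz.le mz.2 le_rfl
    have gx1 : h m1 ≤ h X := hm.monotoneOn M1 mx mx'.1
    have gz2 : h Z ≤ h m2 := hm.monotoneOn mz M2 mz'.2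
    have gAm : h A < h m1 := hm MA M1 h1
    have gBm : h m2 < h B := hm M2 MB hB
    have gxy : h X < h Y := hm mx my lxy
    have gyz : h Y < h Z := hm my mz lyz
    have k1 : (h Z - h Y) * (Y - X) ≤ (1 + σ) * ((h Y - h X) * (Z - Y)) := by
      have p1 : 0 < (h X - h A) * (Z - A) := mul_pos (by linarith) (by linarith [mx'.1])
      refine le_of_mul_le_mul_left ?_ p1
      have q1 : h Z - h A ≤ (1 + σ) * (h X - h A) := by nlinarith
      have q2 : (h Z - h A) * (X - A) ≤ (1 + σ) * (h X - h A) * (Z - A) := by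
        apply mul_le_mul q1 (by linarith) (by linarith [mx'.1])
        exact mul_nonneg (by linarith) (by linarith)
      have q3 : 0 ≤ (h Y - h X) * (Z - Y) := mul_nonneg (by linarith) (by linarith)
      have := mul_le_mul_of_nonneg_right q2 q3
      linarith
    have k2 : (h Y - h X) * (Z - Y) ≤ (1 + σ) * ((h Z - h Y) * (Y - X)) := by
      have p1 : 0 < (h B - h Z) * (B - X) := mul_pos (by linarith) (by linarith [mz'.2])
      refine le_of_mul_le_mul_left ?_ p1
      have q1 : h B - h X ≤ (1 + σ) * (h B - h Z) := by nlinarith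
      have q2 : (h B - h X) * (B - Z) ≤ (1 + σ) * (h B - h Z) * (B - X) := by
        apply mul_le_mul q1 (by linarith) (by linarith [mz'.2])
        exact mul_nonneg (by linarith) (by linarith)
      have q3 : 0 ≤ (h Z - h Y) * (Y - X) := mul_nonneg (by linarith) (by linarith)
      have := mul_le_mul_of_nonneg_right q2 q3
      linarith
    have Dd : 0 < (h m2 - h m1) * (m2 - m1) := mul_pos D d
    have e1 : ∀ U V W : ℝ, (U - h m1) / (h m2 - h m1) - (V - h m1) / (h m2 - h m1) =
        (U - V) / (h m2 - h m1) := by intro U V _; field_simp; ring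
    rw [e1 _ _ 0, e1 _ _ 0]
    constructor
    · have := div_le_div_of_nonneg_right k2 Dd.le
      calc _ = _ := by rw [div_mul_div_comm]
        _ ≤ _ := this
        _ = _ := by rw [div_mul_div_comm, mul_div_assoc]
    · have := div_le_div_of_nonneg_right k1 Dd.le
      calc _ = _ := by rw [div_mul_div_comm]
        _ ≤ _ := this
        _ = _ := by rw [div_mul_div_comm, mul_div_assoc]

end

noncomputable section

lemma Weak.weaken {K K' : ℝ} {φ : ℝ → ℝ} (h : Weak K φ) (hK : K ≤ K') : Weak K' φ :=
  ⟨h.mono, h.cont, h.z0, h.z1, h.cr, h.dp.mono hK h.mono⟩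

lemma half_step {α K c : ℝ} {fm fp : ℝ → ℝ} {gc : ℝ} {gm gp : ℝ → ℝ} {a b : ℕ} {l r σ : ℝ}
    (hα : 1 < α) (S : Sys α K c fm fp) (B : Bas gc gm gp)
    (R : RenData c fm fp gc gm gp (a + 1) b l r) (hσ : 0 ≤ σ) (hK : 1 + σ ≤ K)
    (h1 : r - l ≤ σ * (l - fp c)) (h2 : r - l ≤ σ * (1 - r)) : HalfL α K gc gm := by
  obtain ⟨u, φ, hu, hu1, hw, hf⟩ := S.L
  have c0 := S.c0
  have c1 := S.c1
  have l0 := R.l0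
  have lc := R.lc
  have cr := R.cr
  have rl : 0 < r - l := by linarith
  have gc0 := B.c0
  have hgm0 := R.eL l ⟨le_rfl, lc.le⟩
  rw [sub_self, zero_div, B.z0, mul_zero, add_zero] at hgm0
  have hgmc := R.eL c ⟨lc.le, le_rfl⟩
  rw [← R.gc_eq] at hgmc
  have htop : fp^[a + 1] (fm c) ≤ r := by
    rw [← hgmc]; nlinarith [B.top]
  obtain ⟨X, X1, X2, X3, X4⟩ := S.exists_pre hα a
  obtain ⟨im, ic, icr, i1⟩ := S.iter hα (a + 1) X2.le X3
  have φI : ∀ x ∈ Icc (0:ℝ) 1, φ x ∈ Icc (0:ℝ) 1 := by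
    intro x hx
    have a1 := hw.mono.monotoneOn ⟨le_rfl, zero_le_one⟩ hx hx.1
    have a2 := hw.mono.monotoneOn hx ⟨zero_le_one, le_rfl⟩ hx.2
    rw [hw.z0] at a1
    rw [hw.z1] at a2
    exact ⟨a1, a2⟩
  obtain ⟨A, hA, hAX⟩ := intermediate_value_Icc zero_le_one hw.cont
    (show X ∈ Icc (φ 0) (φ 1) from by rw [hw.z0, hw.z1]; exact ⟨by linarith, X2.le⟩)
  have maps : MapsTo φ (Icc A 1) (Icc X 1) := by
    intro x hx
    have hx' : x ∈ Icc (0:ℝ) 1 := ⟨hA.1.trans hx.1, hx.2⟩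
    refine ⟨?_, (φI x hx').2⟩
    rw [← hAX]; exact hw.mono.monotoneOn hA hx' hx.1
  have sub : Icc A 1 ⊆ Icc (0:ℝ) 1 := fun x hx => ⟨hA.1.trans hx.1, hx.2⟩
  set h : ℝ → ℝ := fun x => fp^[a + 1] (φ x) with hh
  have hm : StrictMonoOn h (Icc A 1) := im.comp (hw.mono.mono sub) maps
  have hc : ContinuousOn h (Icc A 1) := ic.comp (hw.cont.mono sub) maps
  have φcr : CRx φ A 1 := fun p x y q j1 j2 j3 j4 j5 => hw.cr p x y q (hA.1.trans j1) j2 j3 j4 j5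
  have hcr : CRx h A 1 := φcr.comp (hw.mono.mono sub) icr im maps
  have hAe : h A = fp c := by simp only [hh]; rw [hAX, X4]
  have h1e : h 1 = 1 := by simp only [hh]; rw [hw.z1, i1]
  set m1 := qm α u c l with hm1
  have qmem := qm_mem hα hu c0 (show l ∈ Icc 0 c from ⟨l0, lc.le⟩)
  have m1mem : m1 ∈ Icc (0:ℝ) 1 := ⟨qmem.1, qmem.2.trans hu1⟩
  have fml : fm l = φ m1 := hf l ⟨l0, lc.le⟩
  have fmc : fm c = φ u := by rw [hf c ⟨c0.le, le_rfl⟩]; exact congrArg φ (qm_c hα)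
  have hm1l : h m1 = l := by simp only [hh]; rw [← fml]; exact hgm0.symm
  -- position of m1
  have el : fp c < l := by
    by_contra hcon
    have : σ * (l - fp c) ≤ 0 := mul_nonpos_of_nonneg_of_nonpos hσ (by linarith)
    linarith
  have Am1 : A < m1 := by
    by_contra hcon
    push Not at hcon
    have t1 : φ m1 ≤ X := by rw [← hAX]; exact hw.mono.monotoneOn m1mem hA hcon
    have fl1 : fm l ≤ 1 := by rw [fml]; exact (φI m1 m1mem).2
    obtain ⟨jm, -, -, -⟩ := S.iter hα (a + 1) fl1 (fun i hi => (R.oL i hi).le)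
    have := jm.monotoneOn ⟨le_rfl, fl1⟩ (show X ∈ Icc (fm l) 1 from
      ⟨by rw [fml]; exact t1, X2.le⟩) (by rw [fml]; exact t1)
    rw [X4, ← hgm0] at this
    linarith
  have m1u : m1 < u := by
    have := qm_mono hα hu c0 (show l ∈ Icc 0 c from ⟨l0, lc.le⟩)
      (show c ∈ Icc 0 c from ⟨c0.le, le_rfl⟩) lc
    rwa [qm_c hα] at this
  obtain ⟨m2, hm2, hm2r⟩ := intermediate_value_Icc m1mem.2
    (hc.mono (Icc_subset_Icc_left Am1.le))
    (show r ∈ Icc (h m1) (h 1) from by rw [hm1l, h1e]; exact ⟨by linarith, R.r1⟩)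
  have m12 : m1 < m2 := by
    refine lt_of_le_of_ne hm2.1 ?_
    intro e
    rw [← e, hm1l] at hm2r
    linarith
  have um2 : u ≤ m2 := by
    by_contra hcon
    push Not at hcon
    have := hm (show m2 ∈ Icc A 1 from ⟨by linarith, hm2.2⟩)
      (show u ∈ Icc A 1 from ⟨by linarith, hu1⟩) hcon
    rw [hm2r] at this
    simp only [hh] at this
    rw [← fmc] at this
    linarith
  have W := koebe hm hc hcr Am1 m12 hm2.2 hσ
    (by rw [hm2r, hm1l, hAe]; exact h1) (by rw [hm2r, hm1l, h1e]; exact h2)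
  rw [hm2r, hm1l] at W
  have d : 0 < m2 - m1 := by linarith
  refine ⟨(u - m1) / (m2 - m1), _, div_pos (by linarith) d, (div_le_one d).2 (by linarith),
    W.weaken hK, ?_⟩
  intro z hz
  have e0 : gc * (r - l) = c - l := by rw [R.gc_eq]; field_simp
  have xm : l + z * (r - l) ∈ Icc l c := by
    constructor
    · nlinarith [hz.1]
    · nlinarith [hz.2]
  have E := R.eL (l + z * (r - l)) xm
  rw [show (l + z * (r - l) - l) / (r - l) = z by field_simp; ring] at E
  rw [hf _ ⟨l0.trans xm.1, xm.2⟩] at E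
  have gz : gm z = (fp^[a + 1] (φ (u * (1 - ((c - (l + z * (r - l))) / c) ^ α))) - l) / (r - l) := by
    rw [← E]; field_simp; ring
  rw [gz]
  have key : u * (1 - ((c - (l + z * (r - l))) / c) ^ α) =
      m1 + (u - m1) / (m2 - m1) * (1 - ((gc - z) / gc) ^ α) * (m2 - m1) := by
    have w1 : (c - (l + z * (r - l))) / c = ((c - l) / c) * ((gc - z) / gc) := by
      rw [div_mul_div_comm, div_eq_div_iff c0.ne' (by positivity), ← e0]
      have : c - (l + z * (r - l)) = (gc - z) * (r - l) := by linarith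
      rw [this]; ring
    rw [w1, Real.mul_rpow (div_nonneg (by linarith) c0.le) (div_nonneg (by linarith [hz.2]) gc0.le)]
    have : m1 = u * (1 - ((c - l) / c) ^ α) := rfl
    rw [mul_assoc, mul_comm _ (m2 - m1), ← mul_assoc, div_mul_cancel₀ _ d.ne', this]
    ring
  rw [key]

end

noncomputable section

section
variable {α K c : ℝ} {fm fp : ℝ → ℝ} {gc : ℝ} {gm gp : ℝ → ℝ} {a b : ℕ} {l r : ℝ}

lemma Sys.fp_odds (S : Sys α K c fm fp) (hα : 1 < α) {x : ℝ} (hx : c ≤ x) (hx1 : x ≤ 1) :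
    (fp x - fp c) * (1 - x) ≤ K / α * ((x - c) * (1 - fp x)) := by
  have := S.R.odds hα (by linarith [S.c1]) (x := 1 - x) (by linarith) (by linarith)
  simp only [Dl_apply, sub_sub_cancel] at this
  rw [div_mul_eq_mul_div, le_div_iff₀ (by linarith)]
  nlinarith

lemma Sys.fp_le (S : Sys α K c fm fp) {x : ℝ} (hx : c ≤ x) (hx1 : x ≤ 1) : fp x ≤ x := by
  rcases hx1.eq_or_lt with rfl | h
  · exact S.fp_one.le
  · exact (S.right x ⟨hx, h⟩).le

lemma Sys.fp_ge (S : Sys α K c fm fp) (hα : 1 < α) {x : ℝ} (hx : c ≤ x) (hx1 : x ≤ 1) :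
    fp c ≤ fp x := (S.fp_mono hα).monotoneOn ⟨le_rfl, S.c1.le⟩ ⟨hx, hx1⟩ hx

lemma Sys.eps_lt (S : Sys α K c fm fp) : fp c < c := S.right c ⟨le_rfl, S.c1⟩

lemma Sys.lt_eta (S : Sys α K c fm fp) : c < fm c := S.left c ⟨S.c0, le_rfl⟩

lemma Sys.odds_iter (S : Sys α K c fm fp) (hα : 1 < α) (hK : 0 < K) (n : ℕ)
    (ho : ∀ i < n + 1, c ≤ fp^[i] (fm c)) :
    fp^[n + 1] (fm c) ≤ fm c ∧
    (fp^[n + 1] (fm c) - fp c) * (1 - fm c) ≤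
      (K / α) ^ (n + 1) * ((fm c - c) * (1 - fp^[n + 1] (fm c))) := by
  have e1 := S.L.le_one hα S.c0
  have lt := S.lt_eta
  induction n with
  | zero =>
    have := ho 0 (by omega)
    simp only [iterate_zero, id, zero_add, iterate_one, pow_one] at *
    exact ⟨S.fp_le this e1, S.fp_odds hα this e1⟩
  | succ n ih =>
    obtain ⟨h1, h2⟩ := ih (fun i hi => ho i (by omega))
    have h3 := ho (n + 1) (by omega)
    have e : fp^[n + 1 + 1] (fm c) = fp (fp^[n + 1] (fm c)) := iterate_succ_apply' _ _ _
    rw [e]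
    set y := fp^[n + 1] (fm c) with hy
    have hy1 : y ≤ 1 := h1.trans e1
    have h4 := S.fp_odds hα h3 hy1
    have h5 := S.fp_le h3 hy1
    refine ⟨h5.trans h1, ?_⟩
    have k0 : 0 < K / α := div_pos hK (by linarith)
    rcases e1.eq_or_lt with h6 | h6
    · rw [h6]
      have : 0 ≤ (K / α) ^ (n + 1 + 1) * ((1 - c) * (1 - fp y)) := by
        apply mul_nonneg (by positivity)
        exact mul_nonneg (by linarith [S.c1]) (by linarith)
      simpa using this
    · have y1 : 0 < 1 - y := by linarith
      refine le_of_mul_le_mul_left ?_ y1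
      have ec := S.eps_lt
      calc (1 - y) * ((fp y - fp c) * (1 - fm c)) = ((fp y - fp c) * (1 - y)) * (1 - fm c) := by ring
        _ ≤ (K / α * ((y - c) * (1 - fp y))) * (1 - fm c) :=
          mul_le_mul_of_nonneg_right h4 (by linarith)
        _ = (K / α * (1 - fp y)) * ((y - c) * (1 - fm c)) := by ring
        _ ≤ (K / α * (1 - fp y)) * ((y - fp c) * (1 - fm c)) := by
          apply mul_le_mul_of_nonneg_left _ (mul_nonneg k0.le (by linarith))
          exact mul_le_mul_of_nonneg_right (by linarith) (by linarith)
        _ ≤ (K / α * (1 - fp y)) * ((K / α) ^ (n + 1) * ((fm c - c) * (1 - y))) :=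
          mul_le_mul_of_nonneg_left h2 (mul_nonneg k0.le (by linarith))
        _ = _ := by ring

lemma RenData.oLc (R : RenData c fm fp gc gm gp a b l r) (S : Sys α K c fm fp) (hα : 1 < α)
    {x : ℝ} (hx : x ∈ Icc l c) : ∀ i < a, c < fp^[i] (fm x) := by
  intro i hi
  have fx : fm x ≤ 1 := (S.L.le_top hα S.c0 (R.l0.trans hx.1) hx.2).trans (S.L.le_one hα S.c0)
  have lx : fm l ≤ fm x := (S.L.strictMono hα S.c0).monotoneOn ⟨R.l0, R.lc.le⟩
    ⟨R.l0.trans hx.1, hx.2⟩ hx.1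
  have := (S.iter hα i (lx.trans fx) (fun j hj => (R.oL j (by omega)).le)).1.monotoneOn
    ⟨le_rfl, lx.trans fx⟩ ⟨lx, fx⟩ lx
  exact (R.oL i hi).trans_le this

/-- first odds estimate -/
lemma RenData.O1 (R : RenData c fm fp gc gm gp (a + 2) b l r) (S : Sys α K c fm fp) (hα : 1 < α)
    (hK : 0 < K) : (c - fp c) * (1 - fm c) ≤ (K / α) ^ (a + 1) * ((fm c - c) * (1 - c)) := by
  have o := R.oLc S hα (show c ∈ Icc l c from ⟨R.lc.le, le_rfl⟩)
  obtain ⟨h1, h2⟩ := S.odds_iter hα hK a (fun i hi => (o i (by omega)).le)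
  have h3 := o (a + 1) (by omega)
  have e1 := S.L.le_one hα S.c0
  have k0 : 0 < K / α := div_pos hK (by linarith)
  have lt := S.lt_eta
  calc _ ≤ (fp^[a + 1] (fm c) - fp c) * (1 - fm c) :=
        mul_le_mul_of_nonneg_right (by linarith) (by linarith)
    _ ≤ _ := h2
    _ ≤ _ := by
      apply mul_le_mul_of_nonneg_left _ (by positivity)
      exact mul_le_mul_of_nonneg_left (by linarith) (by linarith)

lemma RenData.O2 (R : RenData c fm fp gc gm gp a (b + 2) l r) (S : Sys α K c fm fp) (hα : 1 < α)
    (hK : 0 < K) : (fm c - c) * fp c ≤ (K / α) ^ (b + 1) * ((c - fp c) * c) := by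
  have := R.dual.O1 S.dual hα hK
  simp only [Dl_apply, sub_sub_cancel] at this
  have e1 : 1 - c - (1 - fm c) = fm c - c := by ring
  have e2 : 1 - fp c - (1 - c) = c - fp c := by ring
  rwa [e1, e2] at this

lemma RenData.eps_half (R : RenData c fm fp gc gm gp (a + 2) (b + 2) l r) (S : Sys α K c fm fp)
    (hα : 1 < α) (hK : 0 < K) (ha : (K / α) ^ (a + 1) ≤ 1 / 2) (hb : (K / α) ^ (b + 1) ≤ 1 / 2)
    (hc : c ≤ 1 / 4) : fp c ≤ c / 2 := by
  have o1 := R.O1 S hα hK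
  have o2 := R.O2 S hα hK
  have c0 := S.c0
  have lt := S.lt_eta
  have ec := S.eps_lt
  have e0 := S.eps_nonneg hα
  have p1 : (K / α) ^ (a + 1) * ((fm c - c) * (1 - c)) ≤ 1 / 2 * ((fm c - c) * (1 - c)) :=
    mul_le_mul_of_nonneg_right ha (mul_nonneg (by linarith) (by linarith))
  have p2 : (K / α) ^ (b + 1) * ((c - fp c) * c) ≤ 1 / 2 * ((c - fp c) * c) :=
    mul_le_mul_of_nonneg_right hb (mul_nonneg (by linarith) (by linarith))
  rcases le_total (1 / 2) (fm c) with h | h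
  · have q : 1 / 4 * fp c ≤ (fm c - c) * fp c := mul_le_mul_of_nonneg_right (by linarith) e0
    have q2 : (c - fp c) * c ≤ c * c := mul_le_mul_of_nonneg_right (by linarith) c0.le
    nlinarith
  · have q : (c - fp c) * (1 / 2) ≤ (c - fp c) * (1 - fm c) :=
      mul_le_mul_of_nonneg_left (by linarith) (by linarith)
    have q1 : (fm c - c) * (1 - c) ≤ fm c - c := by nlinarith
    have q2 : c - fp c ≤ fm c - c := by linarith
    have q3 : (c - fp c) * c ≤ (fm c - c) * c := mul_le_mul_of_nonneg_right q2 c0.le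
    refine le_of_mul_le_mul_left ?_ (show 0 < fm c - c by linarith)
    linarith

/-- Step 2 -/
lemma RenData.c_le (R : RenData c fm fp gc gm gp (a + 2) b l r) (S : Sys α K c fm fp)
    (hα : 1 < α) (hK : 1 ≤ K) (he : fp c ≤ c / 2) : c ≤ 2 * K * (fm c) ^ α := by
  have c0 := S.c0
  have c1 := S.c1
  have o : c < fp (fm c) := R.oLc S hα (show c ∈ Icc l c from ⟨R.lc.le, le_rfl⟩) 1 (by omega)
  have e1 := S.L.le_one hα S.c0
  have lt := S.lt_eta
  have e0 := S.eps_nonneg hα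
  have t := S.R.topUpper hα hK (by linarith) (x := 1 - fm c) (by linarith) (by linarith)
  simp only [Dl_apply, sub_sub_cancel] at t
  have w : (1 - c - (1 - fm c)) / (1 - c) ≤ fm c := by
    rw [div_le_iff₀ (by linarith)]; nlinarith
  have w0 : 0 ≤ (1 - c - (1 - fm c)) / (1 - c) := div_nonneg (by linarith) (by linarith)
  have w2 := Real.rpow_le_rpow w0 w (by linarith : 0 ≤ α)
  have w3 : 0 ≤ (fm c) ^ α := Real.rpow_nonneg (by linarith) _
  have q : K * ((1 - fp c) * ((1 - c - (1 - fm c)) / (1 - c)) ^ α) ≤ K * (1 * (fm c) ^ α) := by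
    apply mul_le_mul_of_nonneg_left _ (by linarith)
    exact mul_le_mul (by linarith) w2 (Real.rpow_nonneg w0 _) (by norm_num)
  linarith

/-- Step 3 -/
lemma RenData.fix_r (R : RenData c fm fp gc gm gp a b l r) (B : Bas gc gm gp) :
    fm^[b] (fp r) = r := by
  have := R.eR r ⟨R.cr.le, le_rfl⟩
  rw [div_self (by linarith [R.lc, R.cr]), B.z1] at this
  linarith

lemma RenData.fix_l (R : RenData c fm fp gc gm gp a b l r) (B : Bas gc gm gp) :
    fp^[a] (fm l) = l := by
  have := R.eL l ⟨le_rfl, R.lc.le⟩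
  rw [sub_self, zero_div, B.z0] at this
  linarith

lemma RenData.lin_iter (R : RenData c fm fp gc gm gp a b l r) (S : Sys α K c fm fp)
    (hα : 1 < α) (hK : 1 ≤ K) : ∀ n ≤ b, 0 ≤ fm^[n] (fp r) ∧
      fp r * (fm c) ^ n ≤ (K * c) ^ n * fm^[n] (fp r) := by
  have c0 := S.c0
  have lt := S.lt_eta
  intro n
  induction n with
  | zero =>
    intro _
    have := S.fp_ge hα R.cr.le R.r1
    have := S.eps_nonneg hα
    exact ⟨by simp only [iterate_zero, id]; linarith, by simp⟩
  | succ n ih =>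
    intro hn
    obtain ⟨h1, h2⟩ := ih (by omega)
    have h3 := R.oR n (by omega)
    rw [iterate_succ_apply']
    set z := fm^[n] (fp r) with hz
    refine ⟨S.L.nonneg hα c0 h1 h3.le, ?_⟩
    have h4 := S.L.linLower hα hK c0 h1 h3.le
    have Kc : 0 ≤ (K * c) ^ n := by positivity
    calc fp r * fm c ^ (n + 1) = (fp r * fm c ^ n) * fm c := by ring
      _ ≤ ((K * c) ^ n * z) * fm c := mul_le_mul_of_nonneg_right h2 (by linarith)
      _ = (K * c) ^ n * (fm c * z) := by ring
      _ ≤ (K * c) ^ n * (K * c * fm z) := mul_le_mul_of_nonneg_left h4 Kc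
      _ = _ := by ring

lemma RenData.X_bound (R : RenData c fm fp gc gm gp a b l r) (S : Sys α K c fm fp)
    (B : Bas gc gm gp) (hα : 1 < α) (hK : 1 ≤ K) (he : fp c ≤ 1 / 2) :
    (r - c) ^ α * (fm c) ^ b ≤ 2 * K * (K * c) ^ b := by
  have c0 := S.c0
  have c1 := S.c1
  have lt := S.lt_eta
  have cr := R.cr
  have r1 := R.r1
  have h1 := (R.lin_iter S hα hK b le_rfl).2
  rw [R.fix_r B] at h1
  have t := S.R.topLower hα hK (by linarith) (x := 1 - r) (by linarith) (by linarith)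
  simp only [Dl_apply, sub_sub_cancel] at t
  have w : r - c ≤ (1 - c - (1 - r)) / (1 - c) := by
    rw [le_div_iff₀ (by linarith)]; nlinarith
  have w2 := Real.rpow_le_rpow (by linarith) w (by linarith : 0 ≤ α)
  have w3 : 0 ≤ (r - c) ^ α := Real.rpow_nonneg (by linarith) _
  have e0 := S.eps_nonneg hα
  have q : 1 / 2 * (r - c) ^ α ≤ (1 - fp c) * ((1 - c - (1 - r)) / (1 - c)) ^ α :=
    mul_le_mul (by linarith) w2 w3 (by linarith)
  have q2 : (r - c) ^ α ≤ 2 * K * fp r := by nlinarith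
  have Kc : 0 ≤ (K * c) ^ b := by positivity
  calc _ ≤ (2 * K * fp r) * fm c ^ b := mul_le_mul_of_nonneg_right q2 (pow_nonneg (by linarith) _)
    _ = 2 * K * (fp r * fm c ^ b) := by ring
    _ ≤ 2 * K * ((K * c) ^ b * r) := mul_le_mul_of_nonneg_left h1 (by linarith)
    _ ≤ 2 * K * ((K * c) ^ b * 1) := by
      apply mul_le_mul_of_nonneg_left _ (by linarith)
      exact mul_le_mul_of_nonneg_left r1 Kc
    _ = _ := by ring

/-- Step 4 -/
lemma Sys.fp_lip (S : Sys α K c fm fp) (hα : 1 < α) (hK : 1 ≤ K) (hc : c ≤ 1 / 2) {x y : ℝ}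
    (hx : c ≤ x) (hxy : x ≤ y) (hy : y ≤ 1) : fp y - fp x ≤ 2 * K * α * (y - x) := by
  have t := S.R.lip hα hK (by linarith) (x := 1 - y) (y := 1 - x) (by linarith) (by linarith)
    (by linarith)
  simp only [Dl_apply, sub_sub_cancel] at t
  have m := (S.fp_mono hα).monotoneOn ⟨hx, by linarith⟩ ⟨by linarith, hy⟩ hxy
  have : 1 / 2 * (fp y - fp x) ≤ (1 - c) * (fp y - fp x) :=
    mul_le_mul_of_nonneg_right (by linarith) (by linarith)
  linarith

lemma RenData.Y_bound (R : RenData c fm fp gc gm gp a b l r) (S : Sys α K c fm fp)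
    (B : Bas gc gm gp) (hα : 1 < α) (hK : 1 ≤ K) (hc : c ≤ 1 / 2) :
    c - l ≤ (2 * K * α) ^ a * (K * ((c - l) / c) ^ α) := by
  have c0 := S.c0
  have c1 := S.c1
  have lc := R.lc
  have e1 := S.L.le_one hα S.c0
  have lt := S.lt_eta
  have fl := S.L.le_top hα S.c0 R.l0 lc.le
  have it : ∀ n ≤ a, fp^[n] (fm c) - fp^[n] (fm l) ≤ (2 * K * α) ^ n * (fm c - fm l) := by
    intro n
    induction n with
    | zero => intro _; simp
    | succ n ih =>
      intro hn
      have h1 := ih (by omega)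
      have h2 := R.oL n (by omega)
      obtain ⟨im, -, -, i1⟩ := S.iter hα n (fl.trans e1) (fun i hi => (R.oL i (by omega)).le)
      have h3 := im.monotoneOn ⟨le_rfl, fl.trans e1⟩ ⟨fl, e1⟩ fl
      have h4 := im.monotoneOn ⟨fl, e1⟩ ⟨fl.trans e1, le_rfl⟩ e1
      rw [i1] at h4
      have h5 := S.fp_lip hα hK hc h2.le h3 h4
      rw [iterate_succ_apply', iterate_succ_apply']
      refine h5.trans ?_
      have h6 := mul_le_mul_of_nonneg_left h1 (show 0 ≤ 2 * K * α by positivity)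
      rw [pow_succ]
      linarith
  have h := it a le_rfl
  rw [R.fix_l B] at h
  have hgc := R.eL c ⟨lc.le, le_rfl⟩
  rw [← R.gc_eq] at hgc
  have hg := B.left gc ⟨B.c0, le_rfl⟩
  have e0 : gc * (r - l) = c - l := by
    have : r - l ≠ 0 := by linarith [R.cr]
    rw [R.gc_eq]; field_simp
  have h6 : c ≤ fp^[a] (fm c) := by
    rw [← hgc]
    have := R.cr
    nlinarith
  have t := S.L.topUpper hα hK c0 R.l0 lc.le
  have w : 0 ≤ ((c - l) / c) ^ α := Real.rpow_nonneg (div_nonneg (by linarith) c0.le) _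
  have q : K * (fm c * ((c - l) / c) ^ α) ≤ K * ((c - l) / c) ^ α := by
    apply mul_le_mul_of_nonneg_left _ (by linarith)
    exact mul_le_of_le_one_left w e1
  have p : 0 ≤ (2 * K * α) ^ a := by positivity
  have := mul_le_mul_of_nonneg_left (t.trans q) p
  linarith

end

end

noncomputable section

/-- The arithmetic of step 5. -/
lemma arith5 {α p k2 k1 lL M x y e : ℝ} {a b : ℝ} (hα : 1 < α)
    (hlL : 0 ≤ lL) (hb0 : 0 ≤ b) (hM0 : 0 ≤ M)
    (hx : α * x + b * e ≤ k2 + b * (k1 - M)) (he : -M ≤ k2 + α * e)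
    (hy : y ≤ a * lL + k1 + α * (y + M)) (hab : a ≤ p * b)
    (hM1 : 2 * ((α - 1) * (k1 + k2 / α) + α * p * lL) ≤ (α - 1) ^ 2 / α * M)
    (hM2 : (α - 1) * k2 + α * k1 ≤ M)
    (hb : 3 * α ^ 2 - 2 * α + 1 ≤ b * ((α - 1) ^ 2 / α / 2)) : x ≤ -2 * M + y := by
  have a0 : 0 < α := by linarith
  have a1 : 0 < α - 1 := by linarith
  have e1 : -(M + k2) / α ≤ e := by rw [div_le_iff₀ a0]; linarith
  have h1 : b * (-(M + k2) / α) ≤ b * e := mul_le_mul_of_nonneg_left e1 hb0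
  have h2 : α * x ≤ k2 + b * (k1 - M) + b * ((M + k2) / α) := by
    have : b * (-(M + k2) / α) = - (b * ((M + k2) / α)) := by ring
    linarith
  have h3 := mul_le_mul_of_nonneg_left h2 a1.le
  have h4 : α * (a * lL) ≤ α * (p * b * lL) :=
    mul_le_mul_of_nonneg_left (mul_le_mul_of_nonneg_right hab hlL) a0.le
  have h5 : (α - 1) ^ 2 / α = α - 2 + 1 / α := by field_simp; ring
  have h6 : α * (-α * M - k1 - a * lL) ≤ α * ((α - 1) * y) :=
    mul_le_mul_of_nonneg_left (by linarith) a0.le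
  have h7 := mul_le_mul_of_nonneg_left hM1 hb0
  have h8 := mul_le_mul_of_nonneg_right hb hM0
  have key : α * (α - 1) * x ≤ α * (α - 1) * (-2 * M + y) := by
    have i1 : (α - 1) * (k2 + b * (k1 - M) + b * ((M + k2) / α)) =
      (α - 1) * k2 + b * ((α - 1) * (k1 + k2 / α)) - b * ((α - 1) ^ 2 / α * M) := by
      field_simp; ring
    nlinarith
  exact le_of_mul_le_mul_left key (mul_pos a0 a1)

section
variable {α K c : ℝ} {fm fp : ℝ → ℝ} {gc : ℝ} {gm gp : ℝ → ℝ} {a b : ℕ} {l r : ℝ}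

/-- Step 6 -/
lemma Sys.log_step (S : Sys α K c fm fp) (hα : 1 < α) (hK : 1 ≤ K) {x y : ℝ} (hx : c < x)
    (hxy : x ≤ y) (hy : y ≤ 1) :
    α / K * (Real.log (y - fp c) - Real.log (x - fp c)) ≤
      Real.log (fp y - fp c) - Real.log (fp x - fp c) := by
  have ec := S.eps_lt
  have c1 := S.c1
  have t := S.R.logExp hα hK (by linarith) (x := 1 - y) (y := 1 - x) (by linarith) (by linarith)
    (by linarith)
  simp only [Dl_apply, sub_sub_cancel] at t
  have e1 : ∀ z, 1 - c - (1 - z) = z - c := fun z => by ring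
  have e2 : ∀ z, 1 - fp c - (1 - z) = z - fp c := fun z => by ring
  rw [e1, e1, e2, e2] at t
  refine le_trans ?_ t
  apply mul_le_mul_of_nonneg_left _ (by positivity)
  rw [← Real.log_div (by linarith) (by linarith), ← Real.log_div (by linarith) (by linarith)]
  apply Real.log_le_log (div_pos (by linarith) (by linarith))
  rw [div_le_div_iff₀ (by linarith) (by linarith)]
  nlinarith

lemma Sys.log_iter (S : Sys α K c fm fp) (hα : 1 < α) (hK : 1 ≤ K) {x y : ℝ}
    (hxy : x ≤ y) (hy : y ≤ 1) (n : ℕ) (ho : ∀ i < n, c < fp^[i] x) :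
    (α / K) ^ n * (Real.log (y - fp c) - Real.log (x - fp c)) ≤
      Real.log (fp^[n] y - fp c) - Real.log (fp^[n] x - fp c) := by
  induction n with
  | zero => simp
  | succ n ih =>
    have h1 := ih (fun i hi => ho i (by omega))
    obtain ⟨im, -, -, i1⟩ := S.iter hα n (hxy.trans hy) (fun i hi => (ho i (by omega)).le)
    have h3 := im.monotoneOn ⟨le_rfl, hxy.trans hy⟩ ⟨hxy, hy⟩ hxy
    have h4 := im.monotoneOn ⟨hxy, hy⟩ ⟨hxy.trans hy, le_rfl⟩ hy
    rw [i1] at h4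
    have h5 := S.log_step hα hK (ho n (by omega)) h3 h4
    rw [iterate_succ_apply', iterate_succ_apply']
    refine le_trans ?_ h5
    have := mul_le_mul_of_nonneg_left h1 (show 0 ≤ α / K by positivity)
    rw [pow_succ]
    linarith

lemma RenData.y_small (R : RenData c fm fp gc gm gp a b l r) (S : Sys α K c fm fp)
    (B : Bas gc gm gp) (hα : 1 < α) (hK : 1 ≤ K) {y0 : ℝ} (y00 : 0 < y0) (y01 : y0 ≤ 1 / 8)
    (he : fp c ≤ c / 2) (hr : r ≤ 2 * c) (hN : 7 < (α / K) ^ a * (y0 ^ α / K)) :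
    c - l ≤ y0 * c := by
  by_contra hcon
  push Not at hcon
  have c0 := S.c0
  have c1 := S.c1
  have lc := R.lc
  have cr := R.cr
  have l0 := R.l0
  have e1 := S.L.le_one hα S.c0
  have lt := S.lt_eta
  have ec := S.eps_lt
  have e0 := S.eps_nonneg hα
  have rl : 0 < r - l := by linarith
  set x := c * (1 - y0) with hx
  have lx : l < x := by rw [hx]; linarith
  have xc : x < c := by rw [hx]; nlinarith
  have x0 : 0 < x := by linarith
  have top := S.L.le_top hα c0 x0.le xc.le
  have o := R.oLc S hα (show x ∈ Icc l c from ⟨lx.le, xc.le⟩)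
  have a0 : 0 < a := by
    rcases Nat.eq_zero_or_pos a with h | h
    · exfalso
      subst h
      have y1 : y0 ^ α ≤ 1 := Real.rpow_le_one y00.le (by linarith) (by linarith)
      have : y0 ^ α / K ≤ 1 := (div_le_one (by linarith)).2 (by linarith)
      simp at hN; linarith
    · exact h
  have fx : c < fm x := o 0 a0
  have h := S.log_iter hα hK top e1 a o
  -- lower bound of the initial gap
  have t := S.L.topLower hα hK c0 x0.le xc.le
  have ew : (c - x) / c = y0 := by rw [hx]; field_simp; ring
  rw [ew] at t
  have Y := Real.rpow_pos_of_pos y00 α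
  have Kp : 0 < K := by linarith
  have t2 : fm c * (y0 ^ α / K) ≤ fm c - fm x := by
    rw [mul_div_assoc', div_le_iff₀ Kp]; linarith
  have g1 : y0 ^ α / K ≤ Real.log (fm c - fp c) - Real.log (fm x - fp c) := by
    have q : fm x - fp c ≤ (fm c - fp c) * (1 - y0 ^ α / K) := by
      have : 0 ≤ fp c * (y0 ^ α / K) := by positivity
      linarith
    have w : 0 < 1 - y0 ^ α / K := by
      by_contra hh
      have : (fm c - fp c) * (1 - y0 ^ α / K) ≤ 0 :=
        mul_nonpos_of_nonneg_of_nonpos (by linarith) (by linarith)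
      linarith
    have := Real.log_le_log (by linarith) q
    rw [Real.log_mul (by linarith) w.ne'] at this
    have := Real.log_le_sub_one_of_pos w
    linarith
  -- upper bound of the final gap
  have E := R.eL x ⟨lx.le, xc.le⟩
  have Ec := R.eL c ⟨lc.le, le_rfl⟩
  rw [← R.gc_eq] at Ec
  have b1 : fp^[a] (fm c) ≤ r := by
    rw [← Ec]; nlinarith [B.top]
  have b2 : x < fp^[a] (fm x) := by
    rw [← E]
    have zz := B.left ((x - l) / (r - l)) ⟨div_pos (by linarith) rl, by
      rw [R.gc_eq]; gcongr⟩
    have := mul_lt_mul_of_pos_left zz rl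
    rw [mul_div_cancel₀ _ rl.ne'] at this
    linarith
  have b3 : c / 4 ≤ x - fp c := by rw [hx]; nlinarith
  have fl1 : fm x ≤ 1 := top.trans e1
  have mono := (S.iter hα a fl1 (fun i hi => (o i hi).le)).1.monotoneOn ⟨le_rfl, fl1⟩
    ⟨top, e1⟩ top
  have g2 : Real.log (fp^[a] (fm c) - fp c) - Real.log (fp^[a] (fm x) - fp c) ≤ 7 := by
    have i1 := Real.log_le_log (show 0 < fp^[a] (fm c) - fp c by linarith)
      (show fp^[a] (fm c) - fp c ≤ 8 * (c / 4) by linarith)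
    have i2 := Real.log_le_log (show 0 < c / 4 by linarith)
      (show c / 4 ≤ fp^[a] (fm x) - fp c by linarith)
    rw [Real.log_mul (by norm_num) (by positivity)] at i1
    have := Real.log_le_sub_one_of_pos (show (0:ℝ) < 8 by norm_num)
    linarith
  have lam : 0 ≤ (α / K) ^ a := by positivity
  have := mul_le_mul_of_nonneg_left g1 lam
  linarith

end

end

noncomputable section

set_option maxHeartbeats 2000000 in
theorem step_thm {α K : ℝ} (p : ℝ) (hα : 1 < α) (hK : 1 < K) (hKα : K < α) :
    ∃ (d : ℝ) (N : ℕ), 0 < d ∧ d ≤ 1 / 4 ∧ 2 ≤ N ∧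
      ∀ (c : ℝ) (fm fp : ℝ → ℝ) (gc : ℝ) (gm gp : ℝ → ℝ) (a b : ℕ) (l r : ℝ),
        Sys α K c fm fp → Bas gc gm gp → RenData c fm fp gc gm gp a b l r → c < d →
        N ≤ a → N ≤ b → (a : ℝ) ≤ p * b → Sys α K gc gm gp ∧ 1 - gc ≤ c ^ 2 := by
  set σ := min 1 (K - 1) with hσ
  have σ0 : 0 < σ := lt_min one_pos (by linarith)
  have σ1 : σ ≤ 1 := min_le_left _ _
  have σK : 1 + σ ≤ K := by linarith [min_le_right 1 (K - 1)]
  set y0 := σ / 8 with hy0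
  have y00 : 0 < y0 := by positivity
  have y01 : y0 ≤ 1 / 8 := by linarith
  have Kp : 0 < K := by linarith
  have ap : 0 < α := by linarith
  set ω := (α - 1) ^ 2 / α with hω
  have ω0 : 0 < ω := div_pos (pow_pos (by linarith) 2) ap
  set k2 := Real.log (2 * K) with hk2
  set k1 := Real.log K with hk1
  set lL := Real.log (2 * K * α) with hlL
  have lL0 : 0 ≤ lL := Real.log_nonneg (by nlinarith)
  set M1 := 2 * ((α - 1) * (k1 + k2 / α) + α * p * lL) / ω with hM1
  set M2 := (α - 1) * k2 + α * k1 with hM2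
  set M3 := (k2 + α * Real.log 3) / (α - 1) with hM3
  set M0 := max (max M1 M2) (max M3 (Real.log 4)) with hM0
  have ev1 : ∀ᶠ n : ℕ in atTop, (K / α) ^ n ≤ 1 / 2 :=
    (tendsto_pow_atTop_nhds_zero_of_lt_one (by positivity)
      ((div_lt_one ap).2 hKα)).eventually_le_const (by norm_num)
  have ρ0 : 0 < y0 ^ α / K := div_pos (Real.rpow_pos_of_pos y00 _) Kp
  have ev2 : ∀ᶠ n : ℕ in atTop, 7 < (α / K) ^ n * (y0 ^ α / K) :=
    ((tendsto_pow_atTop_atTop_of_one_lt ((one_lt_div Kp).2 hKα)).atTop_mul_const ρ0).eventually_gt_atTop 7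
  have ev3 : ∀ᶠ n : ℕ in atTop, 3 * α ^ 2 - 2 * α + 1 ≤ (n : ℝ) * (ω / 2) :=
    (tendsto_natCast_atTop_atTop.atTop_mul_const (by positivity)).eventually_ge_atTop _
  obtain ⟨N, hN⟩ := eventually_atTop.1 (ev1.and (ev2.and ev3))
  refine ⟨Real.exp (-M0), N + 2, Real.exp_pos _, ?_, by omega, ?_⟩
  · have : Real.log 4 ≤ M0 := (le_max_right _ _).trans (le_max_right _ _)
    calc Real.exp (-M0) ≤ Real.exp (-Real.log 4) := Real.exp_le_exp.2 (by linarith)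
      _ = 1 / 4 := by rw [Real.exp_neg, Real.exp_log (by norm_num)]; norm_num
  intro c fm fp gc gm gp a b l r S B R hc ha hb hab
  have c0 := S.c0
  have hM : M0 < -Real.log c := by
    have := Real.log_lt_log c0 hc
    rw [Real.log_exp] at this
    linarith
  set M := -Real.log c with hMdef
  have m1 : M1 ≤ M := ((le_max_left _ _).trans (le_max_left _ _)).trans hM.le
  have m2 : M2 ≤ M := ((le_max_right _ _).trans (le_max_left _ _)).trans hM.le
  have m3 : M3 < M := ((le_max_left _ _).trans (le_max_right _ _)).trans_lt hM
  have m4 : Real.log 4 ≤ M := ((le_max_right _ _).trans (le_max_right _ _)).trans hM.le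
  have c4 : c ≤ 1 / 4 := by
    have : Real.log c ≤ Real.log (1 / 4) := by
      rw [one_div, Real.log_inv]; linarith
    exact (Real.log_le_log_iff c0 (by norm_num)).1 this
  have M0' : 0 ≤ M := (Real.log_nonneg (by norm_num)).trans m4
  obtain ⟨a, rfl⟩ : ∃ a', a = a' + 2 := ⟨a - 2, by omega⟩
  obtain ⟨b, rfl⟩ : ∃ b', b = b' + 2 := ⟨b - 2, by omega⟩
  have e := R.eps_half S hα Kp (hN (a + 1) (by omega)).1 (hN (b + 1) (by omega)).1 c4
  have s2 := R.c_le S hα hK.le e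
  have s3 := R.X_bound S B hα hK.le (by linarith)
  have s4 := R.Y_bound S B hα hK.le (by linarith)
  have lt := S.lt_eta
  have cr := R.cr
  have lc := R.lc
  have l0 := R.l0
  have X0 : 0 < r - c := by linarith
  have Y0 : 0 < c - l := by linarith
  have η0 : 0 < fm c := by linarith
  have K2 : 0 < 2 * K := by positivity
  have l2 := Real.log_le_log c0 s2
  rw [Real.log_mul K2.ne' (Real.rpow_pos_of_pos η0 _).ne', Real.log_rpow η0] at l2
  have l3 := Real.log_le_log (mul_pos (Real.rpow_pos_of_pos X0 α) (pow_pos η0 (b + 2))) s3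
  rw [Real.log_mul (Real.rpow_pos_of_pos X0 α).ne' (pow_pos η0 (b + 2)).ne', Real.log_rpow X0,
    Real.log_pow, Real.log_mul K2.ne' (by positivity), Real.log_pow,
    Real.log_mul Kp.ne' c0.ne'] at l3
  have yp : 0 < (c - l) / c := by positivity
  have l4 := Real.log_le_log Y0 s4
  rw [Real.log_mul (by positivity) (mul_pos Kp (Real.rpow_pos_of_pos yp α)).ne', Real.log_pow,
    Real.log_mul Kp.ne' (Real.rpow_pos_of_pos yp α).ne', Real.log_rpow yp,
    Real.log_div Y0.ne' c0.ne'] at l4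
  have key : Real.log (r - c) ≤ -2 * M + Real.log (c - l) := by
    refine arith5 (α := α) (p := p) (k2 := k2) (k1 := k1) (lL := lL) (e := Real.log (fm c))
      (a := ((a + 2 : ℕ) : ℝ)) (b := ((b + 2 : ℕ) : ℝ)) hα lL0 (by positivity) M0' ?_ ?_ ?_ hab
      ?_ m2 ?_
    · rw [hMdef]; linarith
    · rw [hMdef]; linarith
    · rw [hMdef]; linarith
    · rw [hM1, div_le_iff₀ ω0] at m1; linarith
    · exact (hN (b + 2) (by omega)).2.2
  have XY : r - c ≤ c ^ 2 * (c - l) := by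
    have : Real.log (c ^ 2 * (c - l)) = -2 * M + Real.log (c - l) := by
      rw [Real.log_mul (by positivity) Y0.ne', Real.log_pow, hMdef]; push_cast; ring
    rw [← this] at key
    exact (Real.log_le_log_iff X0 (by positivity)).1 key
  have c2 : c ^ 2 ≤ 1 := by nlinarith
  have XY' : r - c ≤ c - l := by nlinarith
  have r2 : r ≤ 2 * c := by linarith
  have s6 := R.y_small S B hα hK.le y00 y01 e r2 (hN (a + 2) (by omega)).2.1
  have η3 : 3 * c ≤ fm c := by
    by_contra hcon
    push Not at hcon
    have t := Real.log_lt_log η0 hcon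
    rw [Real.log_mul (by norm_num) c0.ne'] at t
    rw [hM3, div_lt_iff₀ (by linarith)] at m3
    have := mul_lt_mul_of_pos_left t ap
    rw [hMdef] at m3
    linarith
  have rl : r - l ≤ σ * (c / 4) := by
    have : y0 * c = σ * (c / 8) := by rw [hy0]; ring
    linarith
  have yc : y0 * c ≤ c / 8 := by nlinarith
  have mon : ∀ t, c / 4 ≤ t → r - l ≤ σ * t := fun t ht =>
    rl.trans (mul_le_mul_of_nonneg_left ht σ0.le)
  have HL := half_step hα S B R σ0.le σK (mon _ (by linarith)) (mon _ (by linarith))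
  have HR := half_step (a := b + 1) hα S.dual B.dual R.dual σ0.le σK
    (by simp only [Dl_apply, sub_sub_cancel]
        have := mon (fm c - r) (by linarith)
        rw [show 1 - r - (1 - fm c) = fm c - r by ring]; linarith)
    (by have := mon l (by linarith)
        rw [sub_sub_cancel]; linarith)
  refine ⟨⟨B.c0, B.c1, HL, HR, B.left, B.right⟩, ?_⟩
  have rl0 : 0 < r - l := by linarith
  have e1 : 1 - gc = (r - c) / (r - l) := by rw [R.gc_eq]; field_simp; ring
  rw [e1, div_le_iff₀ rl0]
  have : c ^ 2 * (c - l) ≤ c ^ 2 * (r - l) :=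
    mul_le_mul_of_nonneg_left (by linarith) (by positivity)
  linarith

end

noncomputable section

lemma lorenz_sys {α : ℝ} (hα : 1 < α) (f : LorenzMap α) {δ K : ℝ} (h1 : diffeoNorm f.φ < δ)
    (h2 : diffeoNorm f.ψ < δ) (hK : Real.exp δ ≤ K) : Sys α K f.c f.fm f.fp where
  c0 := f.hc.1
  c1 := f.hc.2
  left := f.hleft
  right := f.hright
  L := by
    have c0 := f.hc.1
    refine ⟨f.u, f.φ, ?_, f.hu.2, sdiffeo_weak f.hφ h1 hK, ?_⟩
    · rcases f.hu.1.eq_or_lt with h | h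
      · have := f.hleft f.c ⟨c0, le_rfl⟩
        rw [qminus, ← h, zero_mul, f.hφ.fix0] at this
        linarith
      · exact h
    · intro x hx
      rw [LorenzMap.fm, qminus, abs_of_nonneg (w_mem c0 hx).1]
  R := by
    have c1 : 0 < 1 - f.c := by linarith [f.hc.2]
    refine ⟨f.v, _, ?_, f.hv.2, (sdiffeo_weak f.hψ h2 hK).refl, ?_⟩
    · rcases f.hv.1.eq_or_lt with h | h
      · have := f.hright f.c ⟨le_rfl, f.hc.2⟩
        rw [qplus, ← h, zero_mul, add_zero, f.hψ.fix1] at this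
        linarith
      · exact h
    · intro x hx
      have e : (1 - x - f.c) / (1 - f.c) = (1 - f.c - x) / (1 - f.c) := by ring
      rw [Dl_apply, LorenzMap.fp, qplus, e, abs_of_nonneg (w_mem c1 hx).1]
      congr 2; ring

lemma Sys.bas {α K c : ℝ} {fm fp : ℝ → ℝ} (hα : 1 < α) (S : Sys α K c fm fp) : Bas c fm fp :=
  ⟨S.c0, S.c1, S.left, S.right, S.L.zero S.c0, S.fp_one, S.L.le_one hα S.c0, S.eps_nonneg hα,
    S.L.cont hα S.c0, S.fp_cont hα⟩

lemma lorenz_bas {α : ℝ} (hα : 1 < α) (f : LorenzMap α) : Bas f.c f.fm f.fp :=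
  (lorenz_sys hα f (δ := max (diffeoNorm f.φ) (diffeoNorm f.ψ) + 1)
    (by linarith [le_max_left (diffeoNorm f.φ) (diffeoNorm f.ψ)])
    (by linarith [le_max_right (diffeoNorm f.φ) (diffeoNorm f.ψ)]) le_rfl).bas hα

lemma Sys.iter_cont_left {α K c : ℝ} {fm fp : ℝ → ℝ} (hα : 1 < α) (S : Sys α K c fm fp) (n : ℕ)
    {X : ℝ} (hX : 0 ≤ X) (ho : ∀ i < n, fm^[i] X ≤ c) : ContinuousOn (fm^[n]) (Icc 0 X) := by
  have := (S.dual.iter hα n (X := 1 - X) (by linarith) (by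
    intro i hi
    rw [Dl_iter, sub_sub_cancel]; linarith [ho i hi])).2.1
  have := refl_cont this
  rw [sub_self, sub_sub_cancel] at this
  refine this.congr ?_
  intro x _
  rw [Dl_apply, Dl_iter]; ring_nf

section
variable {α : ℝ} {f g : LorenzMap α} {l r : ℝ} {a b : ℕ}

lemma toFun_left {x : ℝ} (hx : x < f.c) : f.toFun x = f.fm x := by simp [LorenzMap.toFun, hx]

lemma toFun_right {x : ℝ} (hx : f.c ≤ x) : f.toFun x = f.fp x := by
  simp [LorenzMap.toFun, not_lt.2 hx]

lemma iter_left {x : ℝ} (hx : x < f.c) (ho : ∀ i, 1 ≤ i → i ≤ a → f.c < f.toFun^[i] x) :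
    ∀ i ≤ a, f.toFun^[i + 1] x = f.fp^[i] (f.fm x) := by
  intro i
  induction i with
  | zero => intro _; simp [toFun_left hx]
  | succ i ih =>
    intro hi
    rw [iterate_succ_apply', toFun_right (ho (i + 1) (by omega) hi).le, ih (by omega),
      iterate_succ_apply']

lemma iter_right {x : ℝ} (hx : f.c ≤ x) (ho : ∀ i, 1 ≤ i → i ≤ b → f.toFun^[i] x < f.c) :
    ∀ i ≤ b, f.toFun^[i + 1] x = f.fm^[i] (f.fp x) := by
  intro i
  induction i with
  | zero => intro _; simp [toFun_right hx]
  | succ i ih =>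
    intro hi
    rw [iterate_succ_apply', toFun_left (ho (i + 1) (by omega) hi), ih (by omega),
      iterate_succ_apply']

lemma firstReturn_eq {F : ℝ → ℝ} {C : Set ℝ} {x : ℝ} {n : ℕ} (hn : F^[n + 1] x ∈ C)
    (h : ∀ k, 1 ≤ k → k ≤ n → F^[k] x ∉ C) : firstReturn F C x = n + 1 := by
  apply le_antisymm
  · exact Nat.sInf_le ⟨by omega, hn⟩
  · have := Nat.sInf_mem (s := {k : ℕ | 0 < k ∧ F^[k] x ∈ C}) ⟨n + 1, by omega, hn⟩
    by_contra hc
    exact h _ this.1 (by unfold firstReturn at hc; omega) this.2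

lemma ren_data {K : ℝ} (hα : 1 < α) (S : Sys α K f.c f.fm f.fp) (P : IsRenormPair f g l r)
    (C : ABCombinatorics f l r a b) (ha : 2 ≤ a) (hb : 2 ≤ b) :
    RenData f.c f.fm f.fp g.c g.fm g.fp a b l r := by
  obtain ⟨l0, lc, cr, r1, -, gce, ret⟩ := P
  obtain ⟨-, -, C1, -, -, C2, C3, -, -, C4⟩ := C
  have rl : 0 < r - l := by linarith
  have c0 := S.c0
  have c1 := S.c1
  have G := lorenz_bas hα g
  have frL : ∀ x ∈ Ico l f.c, firstReturn f.toFun (Icc l r) x = a + 1 := by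
    intro x hx
    have hin := C2 (mem_image_of_mem _ hx)
    refine firstReturn_eq hin ?_
    intro k hk1 hka hkC
    have hkc := C1 k hk1 hka x hx
    have n1 := C3 1 le_rfl (by omega) _ ⟨hkc, hkC.2⟩
    rw [← iterate_add_apply, add_comm] at n1
    rcases hka.eq_or_lt with rfl | hlt
    · have n2 := C1 1 le_rfl (by omega) _ ⟨hin.1, n1⟩
      have n3 := C3 2 (by omega) hb _ ⟨hkc, hkC.2⟩
      rw [← iterate_add_apply] at n2 n3
      rw [show 1 + (k + 1) = 2 + k by omega] at n2
      linarith
    · have := C1 (k + 1) (by omega) (by omega) x hx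
      linarith
  have frR : ∀ x ∈ Ioc f.c r, firstReturn f.toFun (Icc l r) x = b + 1 := by
    intro x hx
    have hin := C4 (mem_image_of_mem _ hx)
    refine firstReturn_eq hin ?_
    intro k hk1 hka hkC
    have hkc := C3 k hk1 hka x hx
    have n1 := C1 1 le_rfl (by omega) _ ⟨hkC.1, hkc⟩
    rw [← iterate_add_apply, add_comm] at n1
    rcases hka.eq_or_lt with rfl | hlt
    · have n2 := C3 1 le_rfl (by omega) _ ⟨n1, hin.2⟩
      have n3 := C1 2 (by omega) ha _ ⟨hkC.1, hkc⟩
      rw [← iterate_add_apply] at n2 n3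
      rw [show 1 + (k + 1) = 2 + k by omega] at n2
      linarith
    · have := C3 (k + 1) (by omega) (by omega) x hx
      linarith
  have itL : ∀ x ∈ Ico l f.c, ∀ i ≤ a, f.toFun^[i + 1] x = f.fp^[i] (f.fm x) :=
    fun x hx => iter_left hx.2 (fun i h1 h2 => C1 i h1 h2 x hx)
  have itR : ∀ x ∈ Ioc f.c r, ∀ i ≤ b, f.toFun^[i + 1] x = f.fm^[i] (f.fp x) :=
    fun x hx => iter_right hx.1.le (fun i h1 h2 => C3 i h1 h2 x hx)
  have oL : ∀ i < a, f.c < f.fp^[i] (f.fm l) := by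
    intro i hi
    rw [← itL l ⟨le_rfl, lc⟩ i hi.le]
    exact C1 (i + 1) (by omega) (by omega) l ⟨le_rfl, lc⟩
  have oR : ∀ i < b, f.fm^[i] (f.fp r) < f.c := by
    intro i hi
    rw [← itR r ⟨cr, le_rfl⟩ i hi.le]
    exact C3 (i + 1) (by omega) (by omega) r ⟨cr, le_rfl⟩
  have eL0 : EqOn (fun x => l + (r - l) * g.fm ((x - l) / (r - l)))
      (fun x => f.fp^[a] (f.fm x)) (Ico l f.c) := by
    intro x hx
    have h := (ret x ⟨hx.1, by linarith [hx.2]⟩ hx.2.ne).2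
    rw [frL x hx, itL x hx a le_rfl] at h
    have : (x - l) / (r - l) < g.c := by
      rw [gce]; exact div_lt_div_of_pos_right (by linarith [hx.2]) rl
    rw [toFun_left this] at h
    exact h.symm
  have eR0 : EqOn (fun x => l + (r - l) * g.fp ((x - l) / (r - l)))
      (fun x => f.fm^[b] (f.fp x)) (Ioc f.c r) := by
    intro x hx
    have h := (ret x ⟨by linarith [hx.1], hx.2⟩ hx.1.ne').2
    rw [frR x hx, itR x hx b le_rfl] at h
    have : g.c ≤ (x - l) / (r - l) := by
      rw [gce]; exact div_le_div_of_nonneg_right (by linarith [hx.1]) rl.le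
    rw [toFun_right this] at h
    exact h.symm
  have eL : EqOn (fun x => l + (r - l) * g.fm ((x - l) / (r - l)))
      (fun x => f.fp^[a] (f.fm x)) (Icc l f.c) := by
    refine eL0.of_subset_closure ?_ ?_ Ico_subset_Icc_self (by rw [closure_Ico lc.ne])
    · apply continuousOn_const.add
      apply continuousOn_const.mul
      refine G.contL.comp (by fun_prop) ?_
      intro x hx
      refine ⟨div_nonneg (by linarith [hx.1]) rl.le, ?_⟩
      rw [gce]; exact div_le_div_of_nonneg_right (by linarith [hx.2]) rl.le
    · have fl := S.L.le_top hα c0 l0 lc.le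
      have e1 := S.L.le_one hα c0
      refine (S.iter hα a (fl.trans e1) (fun i hi => (oL i hi).le)).2.1.comp
        ((S.L.cont hα c0).mono (Icc_subset_Icc_left l0)) ?_
      intro x hx
      refine ⟨(S.L.strictMono hα c0).monotoneOn ⟨l0, lc.le⟩ ⟨l0.trans hx.1, hx.2⟩ hx.1, ?_⟩
      exact (S.L.le_top hα c0 (l0.trans hx.1) hx.2).trans e1
  have eR : EqOn (fun x => l + (r - l) * g.fp ((x - l) / (r - l)))
      (fun x => f.fm^[b] (f.fp x)) (Icc f.c r) := by
    refine eR0.of_subset_closure ?_ ?_ Ioc_subset_Icc_self (by rw [closure_Ioc cr.ne])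
    · apply continuousOn_const.add
      apply continuousOn_const.mul
      refine G.contR.comp (by fun_prop) ?_
      intro x hx
      refine ⟨?_, (div_le_one rl).2 (by linarith [hx.2])⟩
      rw [gce]; exact div_le_div_of_nonneg_right (by linarith [hx.1]) rl.le
    · have e0 := S.eps_nonneg hα
      refine (S.iter_cont_left hα b (e0.trans (S.fp_ge hα cr.le r1)) (fun i hi => (oR i hi).le)).comp
        ((S.fp_cont hα).mono (Icc_subset_Icc_right r1)) ?_
      intro x hx
      refine ⟨e0.trans (S.fp_ge hα hx.1 (hx.2.trans r1)), ?_⟩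
      exact (S.fp_mono hα).monotoneOn ⟨hx.1, hx.2.trans r1⟩ ⟨cr.le, r1⟩ hx.2
  exact ⟨l0, lc, cr, r1, gce, oL, oR, eL, eR⟩

lemma ren_data' {K : ℝ} (hα : 1 < α) (S : Sys α K f.c f.fm f.fp) (P : IsRenormalizationOf f g)
    (C : ABRenormalizable f a b) (ha : 2 ≤ a) (hb : 2 ≤ b) :
    ∃ l r, RenData f.c f.fm f.fp g.c g.fm g.fp a b l r := by
  obtain ⟨l, r, ⟨⟨g1, P1⟩, Q1⟩, P⟩ := P
  obtain ⟨l', r', ⟨⟨g2, P2⟩, Q2⟩, C⟩ := C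
  have s1 := Q1 _ _ _ P2
  have s2 := Q2 _ _ _ P1
  have lr : l ≤ r := by linarith [P1.2.1, P1.2.2.1]
  have lr' : l' ≤ r' := by linarith [P2.2.1, P2.2.2.1]
  have t1 := (Icc_subset_Icc_iff lr').1 s1
  have t2 := (Icc_subset_Icc_iff lr).1 s2
  have el : l = l' := le_antisymm t1.1 t2.1
  have er : r = r' := le_antisymm t2.2 t1.2
  subst el er
  exact ⟨l, r, ren_data hα S P C ha hb⟩

end

end

noncomputable section

lemma superexp {e : ℕ → ℝ} {n : ℕ} (h0 : ∀ m, 0 ≤ e m)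
    (h : ∀ k, e (n + k) ≤ (1 / 4 : ℝ) ^ (2 ^ k)) {lam : ℝ} (hl : lam ∈ Ioo (0:ℝ) 1) :
    Tendsto (fun k => e k / lam ^ k) atTop (nhds 0) := by
  obtain ⟨T, hT⟩ := exists_pow_lt_of_lt_one (show 0 < lam / 2 by linarith [hl.1])
    (show (1 / 4 : ℝ) < 1 by norm_num)
  have ev : ∀ᶠ k : ℕ in atTop, T * k ≤ 2 ^ k := by
    have t := tendsto_pow_const_div_const_pow_of_one_lt 1 (show (1:ℝ) < 2 by norm_num)
    have t2 := (t.const_mul (T : ℝ))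
    rw [mul_zero] at t2
    filter_upwards [t2.eventually_le_const (show (0:ℝ) < 1 by norm_num)] with k hk
    rw [pow_one, mul_div_assoc', div_le_one (by positivity)] at hk
    exact_mod_cast hk
  rw [← tendsto_add_atTop_iff_nat n]
  have lim : Tendsto (fun k : ℕ => (1 / lam ^ n) * (1 / 2 : ℝ) ^ k) atTop (nhds 0) := by
    have := (tendsto_pow_atTop_nhds_zero_of_lt_one (show (0:ℝ) ≤ 1 / 2 by norm_num)
      (by norm_num)).const_mul (1 / lam ^ n)
    rwa [mul_zero] at this
  refine tendsto_of_tendsto_of_tendsto_of_le_of_le' tendsto_const_nhds lim ?_ ?_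
  · exact Eventually.of_forall fun k => div_nonneg (h0 _) (pow_nonneg hl.1.le _)
  · filter_upwards [ev] with k hk
    have lp : 0 < lam ^ (k + n) := pow_pos hl.1 _
    rw [div_le_iff₀ lp, add_comm k n]
    have e1 : (1 / 4 : ℝ) ^ (2 ^ k) ≤ (lam / 2) ^ k := by
      calc (1 / 4 : ℝ) ^ (2 ^ k) ≤ (1 / 4 : ℝ) ^ (T * k) :=
            pow_le_pow_of_le_one (by norm_num) (by norm_num) hk
        _ = ((1 / 4 : ℝ) ^ T) ^ k := pow_mul _ _ _
        _ ≤ _ := pow_le_pow_left₀ (by positivity) hT.le k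
    refine ((h k).trans e1).trans (le_of_eq ?_)
    have := (pow_pos hl.1 n).ne'
    rw [pow_add, div_pow, one_div_pow]
    field_simp

theorem degen_aux (α : ℝ) (hα : 1 < α) (p₁ p₂ : ℝ) (hp₁ : 0 < p₁) (hp : p₁ ≤ p₂)
    (δ : ℝ) (hδ : δ < Real.log α / 2) :
    ∃ (d₁ d₂ : ℝ) (N : ℕ), 0 < d₁ ∧ d₁ ≤ d₂ ∧ d₂ < 1 ∧
      ∀ (F : ℕ → LorenzMap α) (A B : ℕ → ℕ) (n : ℕ),
        RenormSeq F → (F n).memL δ →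
        (∀ k, N ≤ A k ∧ N ≤ B k ∧ p₁ ≤ (A k : ℝ) / (B k) ∧ (A k : ℝ) / (B k) ≤ p₂ ∧
          ABRenormalizable (F (n + k)) (A k) (B k)) →
        (F n).c ∉ Set.Icc d₁ d₂ →
        Degenerates F := by
  set K := Real.exp (Real.log α / 2) with hKdef
  have la : 0 < Real.log α := Real.log_pos hα
  have K1 : 1 < K := Real.one_lt_exp_iff.2 (by linarith)
  have Kα : K < α := by
    calc K < Real.exp (Real.log α) := Real.exp_lt_exp.2 (by linarith)
      _ = α := Real.exp_log (by linarith)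
  obtain ⟨d, N, d0, d4, N2, H⟩ := step_thm (max p₂ (1 / p₁)) hα K1 Kα
  refine ⟨d, 1 - d, N, d0, by linarith, by linarith, ?_⟩
  intro F A B n hF hmem hAB hcn
  have S0 : Sys α K (F n).c (F n).fm (F n).fp :=
    lorenz_sys hα (F n) hmem.1 hmem.2 (Real.exp_le_exp.2 hδ.le)
  have rat : ∀ k, (A k : ℝ) ≤ max p₂ (1 / p₁) * B k ∧ (B k : ℝ) ≤ max p₂ (1 / p₁) * A k := by
    intro k
    obtain ⟨-, hb, r1, r2, -⟩ := hAB k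
    have bp : (0:ℝ) < B k := by
      have : 0 < B k := by omega
      exact_mod_cast this
    rw [le_div_iff₀ bp] at r1
    rw [div_le_iff₀ bp] at r2
    constructor
    · exact r2.trans (mul_le_mul_of_nonneg_right (le_max_left _ _) bp.le)
    · have : (B k : ℝ) ≤ 1 / p₁ * A k := by
        rw [one_div_mul_eq_div, le_div_iff₀ hp₁]; linarith
      exact this.trans (mul_le_mul_of_nonneg_right (le_max_right _ _) (by positivity))
  have lowStep : ∀ k, Sys α K (F (n + k)).c (F (n + k)).fm (F (n + k)).fp → (F (n + k)).c < d →
      Sys α K (F (n + k + 1)).c (F (n + k + 1)).fm (F (n + k + 1)).fp ∧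
        1 - (F (n + k + 1)).c ≤ (F (n + k)).c ^ 2 := by
    intro k S hd
    obtain ⟨ha, hb, -, -, hr⟩ := hAB k
    obtain ⟨l, r, R⟩ := ren_data' hα S (hF (n + k)) hr (N2.trans ha) (N2.trans hb)
    exact H _ _ _ _ _ _ _ _ l r S (lorenz_bas hα _) R hd ha hb (rat k).1
  have highStep : ∀ k, Sys α K (F (n + k)).c (F (n + k)).fm (F (n + k)).fp →
      1 - (F (n + k)).c < d →
      Sys α K (F (n + k + 1)).c (F (n + k + 1)).fm (F (n + k + 1)).fp ∧
        (F (n + k + 1)).c ≤ (1 - (F (n + k)).c) ^ 2 := by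
    intro k S hd
    obtain ⟨ha, hb, -, -, hr⟩ := hAB k
    obtain ⟨l, r, R⟩ := ren_data' hα S (hF (n + k)) hr (N2.trans ha) (N2.trans hb)
    obtain ⟨S', h'⟩ := H _ _ _ _ _ _ _ _ _ _ S.dual (lorenz_bas hα _).dual R.dual hd hb ha (rat k).2
    have S'' := S'.dual
    rw [Dl_Dl, Dl_Dl, sub_sub_cancel] at S''
    rw [sub_sub_cancel] at h'
    exact ⟨S'', h'⟩
  set e : ℕ → ℕ → ℝ := fun j m => if Even (j + m) then (F m).c else 1 - (F m).c with he
  have e_even : ∀ j m, Even (j + m) → e j m = (F m).c := fun j m h => by simp [he, h]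
  have e_odd : ∀ j m, ¬ Even (j + m) → e j m = 1 - (F m).c := fun j m h => by simp [he, h]
  have e0 : ∀ j m, 0 ≤ e j m := by
    intro j m
    by_cases h : Even (j + m)
    · rw [e_even j m h]; exact (F m).hc.1.le
    · rw [e_odd j m h]; linarith [(F m).hc.2]
  have emin : ∀ j m, min (F m).c (1 - (F m).c) ≤ e j m := by
    intro j m
    by_cases h : Even (j + m)
    · rw [e_even j m h]; exact min_le_left _ _
    · rw [e_odd j m h]; exact min_le_right _ _
  obtain ⟨j, hj⟩ : ∃ j, e j n < d := by
    by_cases h : (F n).c < d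
    · exact ⟨n, by rw [e_even n n ⟨n, rfl⟩]; exact h⟩
    · refine ⟨n + 1, ?_⟩
      rw [e_odd (n + 1) n (by rw [Nat.even_iff]; omega)]
      by_contra h2
      exact hcn ⟨by linarith, by linarith⟩
  have main : ∀ k, Sys α K (F (n + k)).c (F (n + k)).fm (F (n + k)).fp ∧ e j (n + k) < d ∧
      e j (n + k) ≤ (1 / 4 : ℝ) ^ (2 ^ k) := by
    intro k
    induction k with
    | zero => exact ⟨S0, hj, by simp only [add_zero, pow_zero, pow_one]; linarith⟩
    | succ k ih =>
      obtain ⟨S, h1, h2⟩ := ih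
      have st : Sys α K (F (n + k + 1)).c (F (n + k + 1)).fm (F (n + k + 1)).fp ∧
          e j (n + k + 1) ≤ e j (n + k) ^ 2 := by
        by_cases h : Even (j + (n + k))
        · have h' : ¬ Even (j + (n + k + 1)) := by rw [Nat.even_iff] at *; omega
          rw [e_even _ _ h] at *
          rw [e_odd _ _ h']
          exact lowStep k S h1
        · have h' : Even (j + (n + k + 1)) := by rw [Nat.even_iff] at *; omega
          rw [e_odd _ _ h] at *
          rw [e_even _ _ h']
          exact highStep k S h1
      refine ⟨st.1, ?_, ?_⟩
      · have := e0 j (n + k)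
        have : e j (n + k) ^ 2 ≤ e j (n + k) := by nlinarith
        exact (st.2.trans this).trans_lt h1
      · refine st.2.trans ?_
        rw [pow_succ 2 k, pow_mul]
        exact pow_le_pow_left₀ (e0 _ _) h2 2
  have rate : ∀ lam ∈ Ioo (0:ℝ) 1, Tendsto (fun k => e j k / lam ^ k) atTop (nhds 0) :=
    fun lam hl => superexp (e0 j) (fun k => (main k).2.2) hl
  have lim : Tendsto (fun k => e j k) atTop (nhds 0) := by
    refine squeeze_zero (e0 j) (fun k => ?_) (rate (1 / 2) ⟨by norm_num, by norm_num⟩)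
    rw [le_div_iff₀ (by positivity)]
    exact mul_le_of_le_one_right (e0 j k) (pow_le_one₀ (by norm_num) (by norm_num))
  have t2 : Tendsto (fun k : ℕ => 2 * k) atTop atTop :=
    tendsto_atTop_mono (fun k => by simp only [id]; omega) tendsto_id
  have t3 : Tendsto (fun k : ℕ => 2 * k + 1) atTop atTop :=
    tendsto_atTop_mono (fun k => by simp only [id]; omega) tendsto_id
  have l2 := lim.comp t2
  have l3 := lim.comp t3
  refine ⟨?_, ?_⟩
  · by_cases h : Even j
    · left
      constructor
      · refine l2.congr fun k => ?_
        rw [comp_apply, e_even _ _ (by rw [Nat.even_iff] at *; omega)]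
      · have := l3.const_sub 1
        rw [sub_zero] at this
        refine this.congr fun k => ?_
        rw [comp_apply, e_odd _ _ (by rw [Nat.even_iff] at *; omega)]; ring
    · right
      constructor
      · have := l2.const_sub 1
        rw [sub_zero] at this
        refine this.congr fun k => ?_
        rw [comp_apply, e_odd _ _ (by rw [Nat.even_iff] at *; omega)]; ring
      · refine l3.congr fun k => ?_
        rw [comp_apply, e_even _ _ (by rw [Nat.even_iff] at *; omega)]
  · intro lam hl
    refine squeeze_zero (fun k => ?_) (fun k => ?_) (rate lam hl)
    · exact div_nonneg (le_min (F k).hc.1.le (by linarith [(F k).hc.2])) (pow_nonneg hl.1.le _)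
    · exact div_le_div_of_nonneg_right (emin j k) (pow_nonneg hl.1.le _)

end

/-- **Degeneration Theorem.** For every compact interval `P = [p₁,p₂] ⊂ (0,∞)` and
`δ < (log α)/2` there exist a closed interval `Δ = [d₁,d₂] ⊂ (0,1)` and `N < ∞`
such that: if `F` is a sequence of successive renormalizations of `f = F 0` with
`F n ∈ L_δ` infinitely renormalizable of type `Ω(N;P)` and `c(F n) ∉ Δ` for some
`n ≥ 0`, then the successive renormalizations of `f` degenerate. -/
theorem degeneration (α : ℝ) (hα : 1 < α) (p₁ p₂ : ℝ) (hp₁ : 0 < p₁) (hp : p₁ ≤ p₂)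
    (δ : ℝ) (hδ : δ < Real.log α / 2) :
    ∃ (d₁ d₂ : ℝ) (N : ℕ), 0 < d₁ ∧ d₁ ≤ d₂ ∧ d₂ < 1 ∧
      ∀ (F : ℕ → LorenzMap α) (A B : ℕ → ℕ) (n : ℕ),
        RenormSeq F → (F n).memL δ →
        (∀ k, N ≤ A k ∧ N ≤ B k ∧ p₁ ≤ (A k : ℝ) / (B k) ∧ (A k : ℝ) / (B k) ≤ p₂ ∧
          ABRenormalizable (F (n + k)) (A k) (B k)) →
        (F n).c ∉ Set.Icc d₁ d₂ →
        Degenerates F := by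
  exact degen_aux α hα p₁ p₂ hp₁ hp δ hδ
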